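/- arXiv:2003.02511 — 6 statements merged into one kernel-verified Lean document; each statement's English description precedes it below -/
import Mathlib

section
/- Let n ≥ 2. A sequence S of length n−1 over C_n is zero-sum free if and only if S consists of n−1 copies of a single element g, where g is a generator of C_n. -/
open MeasureTheory Filter

noncomputable def ZeroSumFree {n : ℕ} (S : Multiset (ZMod n)) : Prop :=
  ∀ T : Multiset (ZMod n), T ≤ S → T ≠ 0 → T.sum ≠ 0

/-- `q j d`: number of partitions of `j` with exactly `d` distinct part sizes. -/
noncomputable def numPartsDistinct (j d : ℕ) : ℕ :=
  Nat.card {l : Nat.Partition j // l.parts.toFinset.card = d}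

/-- `X k d`: number of partitions of integers at most `k` with exactly `d` distinct part sizes. -/
noncomputable def X (k d : ℕ) : ℕ := ∑ j ∈ Finset.range (k + 1), numPartsDistinct j d

/-- `Y b c d`: number of partitions of integers at most `b` with at most `c` parts and
exactly `d` distinct part sizes. -/
noncomputable def Y (b c d : ℕ) : ℕ :=
  ∑ j ∈ Finset.range (b + 1),
    Nat.card {l : Nat.Partition j //
      Multiset.card l.parts ≤ c ∧ l.parts.toFinset.card = d}

/-- `N_{ℓ,d}` over `C_n`. -/
noncomputable def zsfCountD (n ℓ d : ℕ) : ℕ :=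
  Nat.card {S : Multiset (ZMod n) //
    Multiset.card S = ℓ ∧ ZeroSumFree S ∧ S.toFinset.card = d}

/-- `N_ℓ` over `C_n`. -/
noncomputable def zsfCount (n ℓ : ℕ) : ℕ :=
  Nat.card {S : Multiset (ZMod n) // Multiset.card S = ℓ ∧ ZeroSumFree S}

/-- Bernoulli(p) measure on `Bool` (for `p ∈ [0,1]`, `min (ofReal p) 1 = ofReal p`). -/
noncomputable def bernoulliMeasure (p : ℝ) : Measure Bool :=
  (PMF.bernoulli (min (Real.toNNReal p) 1) (min_le_right _ _)).toMeasure

/-- Product of Bernoulli(p) measures on `ZMod n → Bool`. -/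
noncomputable def productMeasure : (n : ℕ) → ℝ → Measure (ZMod n → Bool)
  | 0, _ => 0
  | (_ + 1), p => Measure.pi fun _ => bernoulliMeasure p

/-- `N^R_ℓ` : number of zero-sum free multisets of cardinality `ℓ` contained in
`R(f) = {a | f a = true}`. -/
noncomputable def NRcount (n ℓ : ℕ) (f : ZMod n → Bool) : ℕ :=
  Nat.card {S : Multiset (ZMod n) //
    Multiset.card S = ℓ ∧ ZeroSumFree S ∧ ∀ a ∈ S, f a = true}

/-- `N^R_{ℓ,d}` : those with support of size `d`. -/
noncomputable def NRcountD (n ℓ d : ℕ) (f : ZMod n → Bool) : ℕ :=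
  Nat.card {S : Multiset (ZMod n) //
    Multiset.card S = ℓ ∧ ZeroSumFree S ∧ S.toFinset.card = d ∧ ∀ a ∈ S, f a = true}

/-- `D = ⌊(1+√(1+8k))/2⌋`. -/
noncomputable def Dk (k : ℕ) : ℕ := Nat.floor ((1 + Real.sqrt (1 + 8 * (k : ℝ))) / 2)
theorem zsf_all_eq (n : ℕ) (hn : 2 ≤ n) (g h : ZMod n) (L : List (ZMod n))
    (hL : (g :: h :: L).length = n - 1)
    (hz : ZeroSumFree ((g :: h :: L : List (ZMod n)) : Multiset (ZMod n))) : h = g := by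
  have : NeZero n := ⟨by omega⟩
  have key : ∀ i j : ℕ, i < j → j < n →
      ((g :: h :: L).take i).sum ≠ ((g :: h :: L).take j).sum := by
    intro i j hij hj he
    have h1 : (g :: h :: L).take j
        = (g :: h :: L).take i ++ ((g :: h :: L).take j).drop i := by
      conv_lhs => rw [← List.take_append_drop i ((g :: h :: L).take j)]
      rw [List.take_take, min_eq_left hij.le]
    rw [h1, List.sum_append] at he
    have h0 : (((g :: h :: L).take j).drop i).sum = 0 := by
      simpa using he
    refine hz ((((g :: h :: L).take j).drop i : List (ZMod n)) : Multiset (ZMod n)) ?_ ?_ ?_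
    · exact Multiset.coe_le.2
        ((List.drop_sublist _ _).trans (List.take_sublist _ _)).subperm
    · intro hc
      have := congrArg Multiset.card hc
      rw [Multiset.coe_card, List.length_drop, List.length_take, hL, Multiset.card_zero] at this
      omega
    · rw [Multiset.sum_coe]; exact h0
  let f : Fin n → ZMod n := fun i => ((g :: h :: L).take i).sum
  have hf : Function.Injective f := by
    intro a b hab
    rcases lt_trichotomy a.1 b.1 with hl | hl | hl
    · exact absurd hab (key _ _ hl b.2)
    · exact Fin.ext hl
    · exact absurd hab.symm (key _ _ hl a.2)
  have hs : Function.Bijective f :=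
    (Fintype.bijective_iff_injective_and_card f).2 ⟨hf, by simp [ZMod.card]⟩
  obtain ⟨⟨i, hi⟩, hfi⟩ := hs.2 h
  simp only [f] at hfi
  match i, hi, hfi with
  | 0, _, hfi =>
    refine absurd ?_ (hz {h} (by simp) (by simp))
    simpa using hfi.symm
  | 1, _, hfi => simpa using hfi.symm
  | k + 2, _, hfi =>
    refine absurd ?_ (hz ((g :: L.take k : List (ZMod n)) : Multiset (ZMod n)) ?_ (by simp))
    · simp only [List.take_succ_cons, List.sum_cons] at hfi
      rw [Multiset.sum_coe, List.sum_cons]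
      linear_combination hfi
    · exact Multiset.coe_le.2
        (((List.take_sublist k L).trans (List.sublist_cons_self h L)).cons_cons g).subperm

/-- A sequence of length `n-1` over `C_n` is zero-sum free iff it consists of `n-1`
copies of a generator. -/
theorem zero_sum_free_maximal_length_iff (n : ℕ) (hn : 2 ≤ n)
    (S : Multiset (ZMod n)) (hS : Multiset.card S = n - 1) :
    ZeroSumFree S ↔
      ∃ g : ZMod n, addOrderOf g = n ∧ S = Multiset.replicate (n - 1) g := by
  have : NeZero n := ⟨by omega⟩
  constructor
  · intro hz
    obtain ⟨g, hg⟩ := Multiset.card_pos_iff_exists_mem.1 (show 0 < Multiset.card S by omega)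
    have hrep : S = Multiset.replicate (n - 1) g := by
      refine Multiset.eq_replicate.2 ⟨hS, fun b hb => ?_⟩
      by_contra hne
      obtain ⟨S', rfl⟩ := Multiset.exists_cons_of_mem hg
      have hb' : b ∈ S' := (Multiset.mem_cons.1 hb).resolve_left hne
      obtain ⟨R, rfl⟩ := Multiset.exists_cons_of_mem hb'
      obtain ⟨L, rfl⟩ := Quotient.exists_rep R
      exact hne (zsf_all_eq n hn g b L hS hz)
    refine ⟨g, ?_, hrep⟩
    have hdvd : addOrderOf g ∣ n := addOrderOf_dvd_of_nsmul_eq_zero (by simp)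
    have hle := Nat.le_of_dvd (by omega) hdvd
    have hpos : 0 < addOrderOf g := addOrderOf_pos g
    by_contra hne
    refine hz (Multiset.replicate (addOrderOf g) g) ?_ ?_ ?_
    · rw [hrep]
      exact (Multiset.replicate_le_replicate g).2 (by omega)
    · intro hc
      have := congrArg Multiset.card hc
      rw [Multiset.card_replicate, Multiset.card_zero] at this
      omega
    · rw [Multiset.sum_replicate, addOrderOf_nsmul_eq_zero]
  · rintro ⟨g, hg, rfl⟩ T hT hT0 hsum
    obtain ⟨k, hk, rfl⟩ := Multiset.le_replicate_iff.1 hT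
    rw [Multiset.sum_replicate] at hsum
    have hd := addOrderOf_dvd_of_nsmul_eq_zero hsum
    rw [hg] at hd
    have hk0 : k ≠ 0 := by
      rintro rfl
      exact hT0 (by simp)
    have := Nat.le_of_dvd (by omega) hd
    omega
end

section
/- Let n ≥ 2. The maximum length of a zero-sum free sequence over C_n is n−1; that is, every sequence of length n over C_n contains a nonempty zero-sum sub-multiset, and there exists a zero-sum free sequence of length n−1 over C_n. -/
open MeasureTheory Filter

/-- The maximum length of a zero-sum free sequence over `C_n` is `n-1`. -/
theorem davenport_cyclic (n : ℕ) (hn : 2 ≤ n) :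
    (∀ S : Multiset (ZMod n), Multiset.card S = n →
        ∃ T : Multiset (ZMod n), T ≤ S ∧ T ≠ 0 ∧ T.sum = 0) ∧
    (∃ S : Multiset (ZMod n), Multiset.card S = n - 1 ∧ ZeroSumFree S) := by
  haveI : NeZero n := ⟨by omega⟩
  refine ⟨?_, ?_⟩
  · intro S hS
    induction S using Quotient.inductionOn with
    | _ l =>
      have hl : l.length = n := by simpa using hS
      have hcard : Fintype.card (ZMod n) < Fintype.card (Fin (n + 1)) := by
        simp [ZMod.card]
      obtain ⟨i, j, hij, h⟩ := Fintype.exists_ne_map_eq_of_card_lt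
        (fun i : Fin (n + 1) => (l.take i.val).sum) hcard
      have key : ∀ a b : ℕ, a < b → b ≤ n → (l.take a).sum = (l.take b).sum →
          ∃ T : Multiset (ZMod n), T ≤ (l : Multiset (ZMod n)) ∧ T ≠ 0 ∧ T.sum = 0 := by
        intro a b hab hb hs
        refine ⟨(((l.take b).drop a : List (ZMod n)) : Multiset (ZMod n)), ?_, ?_, ?_⟩
        · exact Multiset.coe_le.mpr
            (((List.drop_sublist _ _).trans (List.take_sublist _ _)).subperm)
        · intro h0
          have h1 := congrArg Multiset.card h0
          simp at h1
          omega
        · have h2 := List.sum_take_add_sum_drop (l.take b) a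
          rw [List.take_take, min_eq_left hab.le, hs] at h2
          simpa using h2
      have hne : i.val ≠ j.val := fun h' => hij (Fin.ext h')
      rcases lt_or_gt_of_ne hne with hlt | hlt
      · exact key _ _ hlt (by omega) h
      · exact key _ _ hlt (by omega) h.symm
  · refine ⟨Multiset.replicate (n - 1) 1, by simp, ?_⟩
    intro T hT hT0 hsum
    obtain ⟨k, hk, rfl⟩ := Multiset.le_replicate_iff.mp hT
    rw [Multiset.sum_replicate, nsmul_one, ZMod.natCast_eq_zero_iff] at hsum
    have hk0 : k ≠ 0 := by
      rintro rfl
      exact hT0 (by simp)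
    have := Nat.le_of_dvd (Nat.pos_of_ne_zero hk0) hsum
    omega
end

section
/- For all integers b, c, d with b ≥ d(d+1)/2 and c ≥ d ≥ 2, the recursion Y_{b,c,d} = Σ_{i=1}^{c} Σ_{j=1}^{⌊(b − (d−1)d/2)/i⌋} Y_{b−ij, i−1, d−1} holds. -/
open MeasureTheory Filter

theorem aux_finset_sum (n : ℕ) : ∀ F : Finset ℕ, (∀ x ∈ F, 0 < x) → F.card = n →
    n * (n + 1) / 2 ≤ ∑ x ∈ F, x := by
  induction n with
  | zero => intro F _ _; simp
  | succ n ih =>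
    intro F hpos hcard
    have hne : F.Nonempty := by
      rw [← Finset.card_pos]; omega
    have hm := F.max'_mem hne
    have hle : F.card ≤ F.max' hne := by
      have hsub : F ⊆ Finset.Icc 1 (F.max' hne) := by
        intro x hx
        rw [Finset.mem_Icc]
        exact ⟨hpos x hx, F.le_max' x hx⟩
      simpa using Finset.card_le_card hsub
    have h1 := ih (F.erase (F.max' hne)) (fun x hx => hpos x (Finset.mem_of_mem_erase hx))
      (by rw [Finset.card_erase_of_mem hm]; omega)
    have h2 := Finset.add_sum_erase F (fun x => x) hm
    have h3 : (n + 1) * (n + 1 + 1) = n * (n + 1) + 2 * (n + 1) := by ring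
    omega

theorem aux_multiset_sum (s : Multiset ℕ) (n : ℕ) (hpos : ∀ x ∈ s, 0 < x)
    (hcard : s.toFinset.card = n) : n * (n + 1) / 2 ≤ s.sum := by
  refine (aux_finset_sum n s.toFinset (fun x hx => hpos x (by simpa using hx)) hcard).trans ?_
  have h : s.toFinset.val ≤ s := by
    rw [Multiset.toFinset_val]; exact Multiset.dedup_le s
  obtain ⟨t, ht⟩ := Multiset.le_iff_exists_add.mp h
  have h2 : s.sum = s.toFinset.val.sum + t.sum := by
    conv_lhs => rw [ht]
    simp
  rw [h2, Finset.sum_val]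
  change ∑ x ∈ s.toFinset, x ≤ (∑ x ∈ s.toFinset, x) + t.sum
  exact Nat.le_add_right _ _

/-- The partitions counted by `Y`, as a finset of multisets. -/
noncomputable def TY (b c d : ℕ) : Finset (Multiset ℕ) :=
  (Finset.range (b + 1)).biUnion fun j =>
    ((Finset.univ : Finset (Nat.Partition j)).filter fun l =>
      Multiset.card l.parts ≤ c ∧ l.parts.toFinset.card = d).image Nat.Partition.parts

theorem mem_TY (b c d : ℕ) (s : Multiset ℕ) :
    s ∈ TY b c d ↔ (∀ x ∈ s, 0 < x) ∧ s.sum ≤ b ∧ Multiset.card s ≤ c ∧ s.toFinset.card = d := by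
  simp only [TY, Finset.mem_biUnion, Finset.mem_range, Finset.mem_image, Finset.mem_filter,
    Finset.mem_univ, true_and]
  constructor
  · rintro ⟨j, hj, l, ⟨h1, h2⟩, rfl⟩
    exact ⟨fun x hx => l.parts_pos hx, by rw [l.parts_sum]; omega, h1, h2⟩
  · rintro ⟨h1, h2, h3, h4⟩
    exact ⟨s.sum, by omega, ⟨s, fun {x} hx => h1 x hx, rfl⟩, ⟨h3, h4⟩, rfl⟩

theorem card_TY (b c d : ℕ) : (TY b c d).card = Y b c d := by
  unfold TY Y
  rw [Finset.card_biUnion]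
  · refine Finset.sum_congr rfl fun j _ => ?_
    rw [Finset.card_image_of_injective _ (fun a b h => Nat.Partition.ext h), Nat.card_eq_fintype_card,
      Fintype.card_subtype]
  · intro i _ j _ hij
    rw [Function.onFun, Finset.disjoint_left]
    intro s hs ht
    simp only [Finset.mem_image] at hs ht
    obtain ⟨l, _, rfl⟩ := hs
    obtain ⟨m, _, hm⟩ := ht
    apply hij
    rw [← l.parts_sum, ← m.parts_sum, hm]

/-- Pad with zeros to `i` parts, then add `j` to each part. -/
def padAdd (i j : ℕ) (m : Multiset ℕ) : Multiset ℕ :=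
  (m + Multiset.replicate (i - Multiset.card m) 0).map (· + j)

theorem card_padAdd (i j : ℕ) (m : Multiset ℕ) (h : Multiset.card m ≤ i) :
    Multiset.card (padAdd i j m) = i := by
  simp [padAdd]; omega

theorem mem_padAdd (i j : ℕ) (m : Multiset ℕ) (h : Multiset.card m < i) : j ∈ padAdd i j m := by
  unfold padAdd
  rw [Multiset.mem_map]
  refine ⟨0, ?_, by simp⟩
  rw [Multiset.mem_add, Multiset.mem_replicate]
  right; omega

theorem le_of_mem_padAdd (i j : ℕ) (m : Multiset ℕ) (x : ℕ) (h : x ∈ padAdd i j m) : j ≤ x := by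
  unfold padAdd at h
  rw [Multiset.mem_map] at h
  obtain ⟨a, _, rfl⟩ := h
  omega

theorem sum_padAdd (i j : ℕ) (m : Multiset ℕ) (h : Multiset.card m ≤ i) :
    (padAdd i j m).sum = m.sum + i * j := by
  unfold padAdd
  rw [Multiset.sum_map_add]
  simp [← add_mul, Nat.add_sub_cancel' h]

theorem toFinset_padAdd (i j : ℕ) (m : Multiset ℕ) (h : Multiset.card m < i)
    (hpos : ∀ x ∈ m, 0 < x) : (padAdd i j m).toFinset.card = m.toFinset.card + 1 := by
  have h1 : (padAdd i j m).toFinset = (insert 0 m.toFinset).image (· + j) := by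
    ext x
    have : i - Multiset.card m ≠ 0 := by omega
    simp [padAdd, this]
  rw [h1, Finset.card_image_of_injective _ (add_left_injective j), Finset.card_insert_of_notMem]
  intro h0
  exact absurd (hpos 0 (by simpa using h0)) (by simp)

theorem padAdd_inj (i j : ℕ) (m m' : Multiset ℕ) (hpos : ∀ x ∈ m, 0 < x)
    (hpos' : ∀ x ∈ m', 0 < x) (h : padAdd i j m = padAdd i j m') : m = m' := by
  have h1 := Multiset.map_injective (add_left_injective j) h
  have key : ∀ (k : ℕ) (m : Multiset ℕ), (∀ x ∈ m, 0 < x) →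
      (m + Multiset.replicate k 0).filter (0 < ·) = m := by
    intro k m hm
    rw [Multiset.filter_add, Multiset.filter_eq_self.mpr hm, Multiset.filter_eq_nil.mpr]
    · simp
    · intro a ha
      rw [Multiset.eq_of_mem_replicate ha]; simp
  rw [← key _ m hpos, h1, key _ m' hpos']

theorem exists_padAdd (s : Multiset ℕ) (j : ℕ) (hj : j ∈ s) (hmin : ∀ x ∈ s, j ≤ x) :
    ∃ m : Multiset ℕ, (∀ x ∈ m, 0 < x) ∧ Multiset.card m < Multiset.card s ∧
      padAdd (Multiset.card s) j m = s := by
  set t := s.map (· - j) with ht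
  have hts : t.map (· + j) = s := by
    rw [ht, Multiset.map_map]
    conv_rhs => rw [← Multiset.map_id s]
    refine Multiset.map_congr rfl fun x hx => ?_
    have := hmin x hx
    simp; omega
  have hsplit : t.filter (0 < ·) + Multiset.replicate (t.count 0) 0 = t := by
    conv_rhs => rw [← Multiset.filter_add_not (0 < ·) t]
    congr 1
    rw [← Multiset.filter_eq']
    refine Multiset.filter_congr fun x _ => ?_
    omega
  have h0 : 0 < t.count 0 := by
    rw [Multiset.count_pos, ht, Multiset.mem_map]
    exact ⟨j, hj, by simp⟩
  have hcard : Multiset.card (t.filter (0 < ·)) + t.count 0 = Multiset.card s := by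
    have := congrArg Multiset.card hsplit
    rw [Multiset.card_add, Multiset.card_replicate] at this
    rw [this, ht, Multiset.card_map]
  refine ⟨t.filter (0 < ·), fun x hx => (Multiset.mem_filter.mp hx).2, by omega, ?_⟩
  unfold padAdd
  rw [show Multiset.card s - Multiset.card (t.filter (0 < ·)) = t.count 0 by omega, hsplit, hts]

/-- Recursive formula for `Y_{b,c,d}` when `b ≥ d(d+1)/2` and `c ≥ d ≥ 2`. -/
theorem Y_recursion (b c d : ℕ) (hb : d * (d + 1) / 2 ≤ b) (hc : d ≤ c) (hd : 2 ≤ d) :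
    Y b c d = ∑ i ∈ Finset.Icc 1 c,
      ∑ j ∈ Finset.Icc 1 ((b - (d - 1) * d / 2) / i), Y (b - i * j) (i - 1) (d - 1) := by
  simp only [← card_TY]
  rw [Finset.sum_sigma', ← Finset.card_sigma]
  symm
  refine Finset.card_bij (fun p _ => padAdd p.1.1 p.1.2 p.2) ?_ ?_ ?_
  · rintro ⟨⟨i, j⟩, m⟩ h
    simp only [Finset.mem_sigma, Finset.mem_Icc, mem_TY] at h ⊢
    obtain ⟨⟨⟨hi1, hic⟩, hj1, hj⟩, hpos, hsum, hcard, hdd⟩ := h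
    rw [Nat.le_div_iff_mul_le (by omega), mul_comm] at hj
    refine ⟨fun x hx => ?_, ?_, ?_, ?_⟩
    · have := le_of_mem_padAdd _ _ _ _ hx
      omega
    · rw [sum_padAdd _ _ _ (by omega)]; omega
    · rw [card_padAdd _ _ _ (by omega)]; omega
    · rw [toFinset_padAdd _ _ _ (by omega) hpos]; omega
  · rintro ⟨⟨i, j⟩, m⟩ h ⟨⟨i', j'⟩, m'⟩ h' heq
    simp only [Finset.mem_sigma, Finset.mem_Icc, mem_TY] at h h' heq
    obtain ⟨⟨⟨hi1, hic⟩, hj1, hj⟩, hpos, hsum, hcard, hdd⟩ := h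
    obtain ⟨⟨⟨hi1', hic'⟩, hj1', hj'⟩, hpos', hsum', hcard', hdd'⟩ := h'
    have e1 := congrArg Multiset.card heq
    rw [card_padAdd _ _ _ (by omega), card_padAdd _ _ _ (by omega)] at e1
    subst e1
    have l1 := le_of_mem_padAdd _ _ _ _ (heq ▸ mem_padAdd i j m (by omega))
    have l2 := le_of_mem_padAdd _ _ _ _ (heq.symm ▸ mem_padAdd i j' m' (by omega))
    have e2 : j = j' := le_antisymm l2 l1
    subst e2
    rw [padAdd_inj i j m m' hpos hpos' heq]
  · intro s hs
    rw [mem_TY] at hs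
    obtain ⟨hpos, hsum, hcard, hdd⟩ := hs
    have hne : s.toFinset.Nonempty := by
      rw [← Finset.card_pos]; omega
    have hjm : s.toFinset.min' hne ∈ s := by simpa using s.toFinset.min'_mem hne
    have hmin : ∀ x ∈ s, s.toFinset.min' hne ≤ x := fun x hx =>
      s.toFinset.min'_le x (by simpa using hx)
    generalize s.toFinset.min' hne = j at hjm hmin
    obtain ⟨m, hm, hmc, hms⟩ := exists_padAdd s j hjm hmin
    have hs1 := sum_padAdd (Multiset.card s) j m hmc.le
    have hs2 := toFinset_padAdd (Multiset.card s) j m hmc hm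
    rw [hms] at hs1 hs2
    have hlow := aux_multiset_sum m (d - 1) hm (by omega)
    rw [show d - 1 + 1 = d by omega] at hlow
    refine ⟨⟨⟨Multiset.card s, j⟩, m⟩, ?_, hms⟩
    simp only [Finset.mem_sigma, Finset.mem_Icc, mem_TY]
    refine ⟨⟨⟨by omega, hcard⟩, hpos j hjm, ?_⟩, hm, by omega, by omega, by omega⟩
    rw [Nat.le_div_iff_mul_le (by omega), mul_comm]
    omega
end

section
/- For every integer k ≥ 0 there exists a constant C > 0, depending only on k, such that for all n ≥ 2 with k ≤ ⌊n/3⌋ and all p ∈ [0,1], the expectation of N^R_{n−1−k} satisfies | E(N^R_{n−1−k}) − p·φ(n) | ≤ C · p² · φ(n). -/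
open MeasureTheory Filter

/-- Set of all subsums, including the empty one. -/
noncomputable def subsums {n : ℕ} (S : Multiset (ZMod n)) : Set (ZMod n) :=
  {a | ∃ T ≤ S, T.sum = a}

lemma ZeroSumFree.mono {n : ℕ} {S T : Multiset (ZMod n)} (h : ZeroSumFree S) (hT : T ≤ S) :
    ZeroSumFree T := fun U hU h0 => h U (hU.trans hT) h0

lemma subsums_gain {n : ℕ} {S T U : Multiset (ZMod n)} (h : ZeroSumFree (S + T)) (hU : U ≤ T)
    (h0 : U ≠ 0) : S.sum + U.sum ∉ subsums S := by
  rintro ⟨V, hV, hs⟩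
  obtain ⟨W, rfl⟩ := Multiset.le_iff_exists_add.1 hV
  have : (W + U).sum = 0 := by
    rw [Multiset.sum_add] at *
    linear_combination -hs
  refine h (W + U) ?_ ?_ this
  · exact add_le_add (Multiset.le_add_left _ _) hU
  · intro h
    exact h0 (by simpa using (add_eq_zero.1 h).2)

lemma subsums_mem {n : ℕ} {S T U : Multiset (ZMod n)} (hU : U ≤ T) :
    S.sum + U.sum ∈ subsums (S + T) :=
  ⟨S + U, add_le_add le_rfl hU, by simp⟩

lemma subsums_mono {n : ℕ} (S T : Multiset (ZMod n)) : subsums S ⊆ subsums (S + T) := by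
  rintro a ⟨U, hU, rfl⟩
  exact ⟨U, hU.trans (Multiset.le_add_right _ _), rfl⟩

lemma gain_one {n : ℕ} [NeZero n] {S : Multiset (ZMod n)} {x : ZMod n}
    (h : ZeroSumFree (S + {x})) : (subsums S).ncard + 1 ≤ (subsums (S + {x})).ncard := by
  have h1 := subsums_gain h (U := {x}) le_rfl (by simp)
  have h2 := subsums_mem (S := S) (T := {x}) (U := {x}) le_rfl
  rw [← Set.ncard_insert_of_notMem h1 (Set.toFinite _)]
  exact Set.ncard_le_ncard (Set.insert_subset h2 (subsums_mono _ _)) (Set.toFinite _)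

lemma gain_two {n : ℕ} [NeZero n] {S : Multiset (ZMod n)} {x y : ZMod n} (hxy : x ≠ y)
    (h : ZeroSumFree (S + {x, y})) : (subsums S).ncard + 3 ≤ (subsums (S + {x, y})).ncard := by
  have hx : ({x} : Multiset (ZMod n)) ≤ {x, y} := by simp
  have hy : ({y} : Multiset (ZMod n)) ≤ {x, y} := by simp
  have hx0 : x ≠ 0 := by
    have := h {x} (hx.trans (Multiset.le_add_left _ _)) (by simp)
    simpa using this
  have hy0 : y ≠ 0 := by
    have := h {y} (hy.trans (Multiset.le_add_left _ _)) (by simp)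
    simpa using this
  have a1 := subsums_gain h hx (by simp)
  have a2 := subsums_gain h hy (by simp)
  have a3 := subsums_gain h (U := {x, y}) le_rfl (by simp)
  have b1 := subsums_mem (S := S) hx
  have b2 := subsums_mem (S := S) hy
  have b3 := subsums_mem (S := S) (T := {x, y}) (U := {x, y}) le_rfl
  simp only [Multiset.sum_singleton, Multiset.insert_eq_cons, Multiset.sum_cons] at a1 a2 a3 b1 b2 b3
  have c3 := Set.ncard_insert_of_notMem a3 (Set.toFinite _)
  have c2 := Set.ncard_insert_of_notMem
    (a := S.sum + y) (s := insert (S.sum + (x + y)) (subsums S))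
    (by simp [a2, hx0]) (Set.toFinite _)
  have c1 := Set.ncard_insert_of_notMem
    (a := S.sum + x) (s := insert (S.sum + y) (insert (S.sum + (x + y)) (subsums S)))
    (by simp [a1, hy0, hxy]) (Set.toFinite _)
  have := Set.ncard_le_ncard (Set.insert_subset b1 (Set.insert_subset b2
    (Set.insert_subset b3 (subsums_mono S {x, y})))) (Set.toFinite _)
  simp only [Multiset.insert_eq_cons] at this ⊢
  omega

lemma card_le_subsums {n : ℕ} [NeZero n] (S : Multiset (ZMod n)) (h : ZeroSumFree S) :
    S.card + 1 ≤ (subsums S).ncard := by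
  induction S using Multiset.induction with
  | empty =>
    have : (0 : ZMod n) ∈ subsums (0 : Multiset (ZMod n)) := ⟨0, le_rfl, by simp⟩
    have := (Set.ncard_pos (Set.toFinite _)).2 ⟨_, this⟩
    simp only [Multiset.card_zero]
    omega
  | cons a S ih =>
    have e : a ::ₘ S = S + {a} := by rw [← Multiset.singleton_add, add_comm]
    rw [e] at h ⊢
    have := gain_one h
    have := ih (h.mono (Multiset.le_add_right _ _))
    simp
    omega

lemma exists_big {n : ℕ} [NeZero n] : ∀ (l : ℕ) (S : Multiset (ZMod n)), S.card = l →
    ZeroSumFree S → ∃ (g : ZMod n) (t : ℕ), S.card ≤ 2 * t + S.count g ∧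
      S.card + 1 + t ≤ (subsums S).ncard := by
  intro l
  induction l using Nat.strong_induction_on with
  | _ l ih =>
    intro S hl h
    by_cases hg : ∃ g, ∀ x ∈ S, x = g
    · obtain ⟨g, hg⟩ := hg
      refine ⟨g, 0, ?_, by have := card_le_subsums S h; omega⟩
      have := Multiset.eq_replicate_of_mem hg
      rw [this]
      simp
    · push Not at hg
      obtain ⟨x, hx, -⟩ := hg 0
      obtain ⟨y, hy, hyx⟩ := hg x
      obtain ⟨S1, rfl⟩ := Multiset.exists_cons_of_mem hx
      have hy1 : y ∈ S1 := by simpa [hyx] using hy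
      obtain ⟨S2, rfl⟩ := Multiset.exists_cons_of_mem hy1
      have e : x ::ₘ y ::ₘ S2 = S2 + {x, y} := by
        rw [add_comm]; simp [Multiset.insert_eq_cons]
      rw [e] at h ⊢
      simp at hl
      obtain ⟨g, t, h1, h2⟩ := ih S2.card (by omega) S2 rfl (h.mono (Multiset.le_add_right _ _))
      have := gain_two hyx.symm h
      refine ⟨g, t + 1, ?_, ?_⟩
      · rw [Multiset.count_add]; simp; omega
      · simp at this ⊢; omega

lemma isUnit_of_replicate {n m : ℕ} [NeZero n] {g : ZMod n} (hm : n / 2 ≤ m)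
    (h : ZeroSumFree (Multiset.replicate m g)) : IsUnit g := by
  have hn : 0 < n := NeZero.pos n
  obtain ⟨a, rfl⟩ : ∃ a : ℕ, (a : ZMod n) = g := ⟨g.val, by simp⟩
  rw [ZMod.isUnit_iff_coprime]
  by_contra hc
  have hd : 2 ≤ a.gcd n := by
    have : 0 < a.gcd n := Nat.gcd_pos_of_pos_right _ hn
    unfold Nat.Coprime at hc
    omega
  obtain ⟨u, hu⟩ := Nat.gcd_dvd_left a n
  obtain ⟨v, hv⟩ := Nat.gcd_dvd_right a n
  have hv0 : v ≠ 0 := by rintro rfl; simp at hv; omega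
  have hvm : v ≤ m := by
    have : 2 * v ≤ n := by
      conv_rhs => rw [hv]
      exact Nat.mul_le_mul_right _ hd
    omega
  refine h (Multiset.replicate v (a : ZMod n)) (Multiset.replicate_le_replicate _ |>.2 hvm)
    (by intro h; apply hv0; simpa using congrArg Multiset.card h) ?_
  rw [Multiset.sum_replicate, nsmul_eq_mul, ← Nat.cast_mul, ZMod.natCast_eq_zero_iff]
  refine ⟨u, ?_⟩
  conv_lhs => rw [hu]
  conv_rhs => rw [hv]
  ring

lemma zsf_replicate {n m : ℕ} (hm : m < n) {g : ZMod n} (hg : IsUnit g) :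
    ZeroSumFree (Multiset.replicate m g) := by
  intro T hT h0 hs
  obtain ⟨j, hj, rfl⟩ := Multiset.le_replicate_iff.1 hT
  rw [Multiset.sum_replicate, nsmul_eq_mul, hg.mul_left_eq_zero, ZMod.natCast_eq_zero_iff] at hs
  have : j ≠ 0 := by rintro rfl; simp at h0
  exact this (Nat.eq_zero_of_dvd_of_lt hs (by omega))

lemma finite_zsf (n l : ℕ) [NeZero n] :
    {S : Multiset (ZMod n) | S.card = l ∧ ZeroSumFree S}.Finite := by
  have : Finite {S : Multiset (ZMod n) // S.card = l} :=
    inferInstanceAs (Finite (Sym (ZMod n) l))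
  have hf : {S : Multiset (ZMod n) | S.card = l}.Finite := this
  exact hf.subset (fun S h => h.1)

noncomputable def zsfFinset (n l : ℕ) [NeZero n] : Finset (Multiset (ZMod n)) :=
  (finite_zsf n l).toFinset

lemma mem_zsfFinset {n l : ℕ} [NeZero n] {S : Multiset (ZMod n)} :
    S ∈ zsfFinset n l ↔ S.card = l ∧ ZeroSumFree S := by
  simp [zsfFinset]

/-- Decoding map for zero-sum free sequences. -/
noncomputable def decode (n k : ℕ) (q : (ZMod n)ˣ × Sym (Fin (3 * k + 1)) (2 * k)) :
    Multiset (ZMod n) :=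
  Multiset.replicate (n - 1 - 3 * k) (q.1 : ZMod n) +
    q.2.1.map (fun i : Fin (3 * k + 1) => ((i : ℕ) : ZMod n) * (q.1 : ZMod n))

lemma exists_decode {n k : ℕ} [NeZero n] (hn : 6 * k + 2 ≤ n) {S : Multiset (ZMod n)}
    (hc : S.card = n - 1 - k) (h : ZeroSumFree S) : ∃ q, decode n k q = S := by
  obtain ⟨g, t, h1, h2⟩ := exists_big _ S rfl h
  have h3 : (subsums S).ncard ≤ n := by
    simpa using Set.ncard_le_card (subsums S)
  have hm : n - 1 - 3 * k ≤ S.count g := by omega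
  have hle := Multiset.le_count_iff_replicate_le.1 hm
  have hu : IsUnit g := isUnit_of_replicate (m := n - 1 - 3 * k) (by omega) (h.mono hle)
  obtain ⟨g, rfl⟩ := hu
  obtain ⟨R, rfl⟩ := Multiset.le_iff_exists_add.1 hle
  have hR : R.card = 2 * k := by simp at hc; omega
  have hb : ∀ x ∈ R, (x * ((g⁻¹ : (ZMod n)ˣ) : ZMod n)).val < 3 * k + 1 := by
    intro x hx
    by_contra hcon
    set a := (x * ((g⁻¹ : (ZMod n)ˣ) : ZMod n)).val with ha
    have hax : (a : ZMod n) * g = x := by simp [ha, mul_assoc]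
    have han : a < n := ZMod.val_lt _
    refine h (Multiset.replicate (n - a) (g : ZMod n) + {x})
      (add_le_add ((Multiset.replicate_le_replicate _).2 (by omega)) (by simpa using hx))
      (by intro h; simpa using congrArg Multiset.card h) ?_
    rw [Multiset.sum_add, Multiset.sum_replicate, nsmul_eq_mul, Multiset.sum_singleton, ← hax,
      ← add_mul, ← Nat.cast_add, Nat.sub_add_cancel han.le]
    simp
  refine ⟨(g, ⟨R.map (fun x => Fin.ofNat (3 * k + 1) (x * ((g⁻¹ : (ZMod n)ˣ) : ZMod n)).val),
    by simpa using hR⟩), ?_⟩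
  simp only [decode, Sym.coe_mk, Multiset.map_map]
  congr 1
  conv_rhs => rw [← Multiset.map_id R]
  apply Multiset.map_congr rfl
  intro x hx
  simp [Fin.val_ofNat, Nat.mod_eq_of_lt (hb x hx), mul_assoc]

lemma card_zsf_large {n k : ℕ} [NeZero n] (hn : 6 * k + 2 ≤ n) :
    (zsfFinset n (n - 1 - k)).card ≤
      Nat.totient n * Fintype.card (Sym (Fin (3 * k + 1)) (2 * k)) := by
  classical
  rw [← ZMod.card_units_eq_totient, ← Fintype.card_prod]
  calc _ ≤ ((Finset.univ).image (decode n k)).card := by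
        apply Finset.card_le_card
        intro S hS
        rw [mem_zsfFinset] at hS
        obtain ⟨q, hq⟩ := exists_decode hn hS.1 hS.2
        exact Finset.mem_image.2 ⟨q, Finset.mem_univ _, hq⟩
    _ ≤ _ := Finset.card_image_le

lemma card_zsf_single {n l : ℕ} [NeZero n] (hl : l < n) (hl0 : 0 < l) (hl2 : n / 2 ≤ l) :
    ((zsfFinset n l).filter (fun S => S.toFinset.card = 1)).card = Nat.totient n := by
  classical
  rw [← ZMod.card_units_eq_totient, ← Finset.card_univ]
  symm
  refine Finset.card_bij (fun g _ => Multiset.replicate l (g : ZMod n)) ?_ ?_ ?_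
  · intro g _
    rw [Finset.mem_filter, mem_zsfFinset]
    refine ⟨⟨by simp, zsf_replicate hl g.isUnit⟩, ?_⟩
    rw [Multiset.toFinset_replicate, if_neg hl0.ne']
    simp
  · intro a _ b _ hab
    exact Units.ext (Multiset.replicate_right_injective hl0.ne' hab)
  · intro S hS
    rw [Finset.mem_filter, mem_zsfFinset] at hS
    obtain ⟨⟨hc, hz⟩, h1⟩ := hS
    obtain ⟨a, ha⟩ := Finset.card_eq_one.1 h1
    have hS : S = Multiset.replicate l a := by
      rw [← hc]
      apply Multiset.eq_replicate_of_mem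
      intro x hx
      have : x ∈ S.toFinset := by simpa using hx
      simpa [ha] using this
    rw [hS] at hz
    obtain ⟨g, rfl⟩ := isUnit_of_replicate hl2 hz
    exact ⟨g, Finset.mem_univ _, hS.symm⟩

instance (p : ℝ) : IsProbabilityMeasure (bernoulliMeasure p) := by
  unfold bernoulliMeasure; infer_instance

lemma bernoulliMeasure_true {p : ℝ} (hp : p ∈ Set.Icc (0 : ℝ) 1) :
    bernoulliMeasure p {true} = ENNReal.ofReal p := by
  unfold bernoulliMeasure
  rw [PMF.toMeasure_apply_singleton _ _ (MeasurableSet.singleton _)]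
  have : p.toNNReal ≤ 1 := by simpa using hp.2
  rw [PMF.bernoulli_apply]
  simp [this, ENNReal.ofReal]

lemma productMeasure_eq (n : ℕ) [NeZero n] (p : ℝ) :
    productMeasure n p = Measure.pi fun _ => bernoulliMeasure p := by
  obtain ⟨m, rfl⟩ := Nat.exists_eq_succ_of_ne_zero (NeZero.ne n)
  unfold productMeasure
  congr!

lemma measure_contains {n : ℕ} [NeZero n] {p : ℝ} (hp : p ∈ Set.Icc (0 : ℝ) 1)
    (S : Multiset (ZMod n)) :
    (productMeasure n p).real {f | ∀ a ∈ S, f a = true} = p ^ S.toFinset.card := by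
  classical
  have : {f : ZMod n → Bool | ∀ a ∈ S, f a = true} =
      Set.pi Set.univ (fun a => if a ∈ S.toFinset then {true} else Set.univ) := by
    ext f
    simp only [Set.mem_ofPred_eq, Set.mem_pi, Set.mem_univ, true_imp_iff]
    refine forall_congr' fun a => ?_
    by_cases h : a ∈ S <;> simp [h]
  rw [measureReal_def, productMeasure_eq, this, Measure.pi_pi]
  have : ∀ a : ZMod n, bernoulliMeasure p (if a ∈ S.toFinset then {true} else Set.univ) =
      if a ∈ S.toFinset then ENNReal.ofReal p else 1 := by
    intro a
    split_ifs
    · exact bernoulliMeasure_true hp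
    · exact measure_univ
  simp_rw [this]
  rw [Finset.prod_ite_mem]
  simp [ENNReal.toReal_ofReal hp.1]

lemma NRcount_eq {n : ℕ} [NeZero n] (l : ℕ) (f : ZMod n → Bool) :
    (NRcount n l f : ℝ) = ∑ S ∈ zsfFinset n l,
      Set.indicator {f : ZMod n → Bool | ∀ a ∈ S, f a = true} (fun _ => (1 : ℝ)) f := by
  classical
  simp only [Set.indicator_apply, Set.mem_ofPred_eq, Finset.sum_boole]
  unfold NRcount
  congr 1
  apply Nat.subtype_card
  intro S
  rw [Finset.mem_filter, mem_zsfFinset, and_assoc]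

lemma integral_eq {n : ℕ} [NeZero n] (l : ℕ) {p : ℝ} (hp : p ∈ Set.Icc (0 : ℝ) 1) :
    ∫ f, (NRcount n l f : ℝ) ∂(productMeasure n p) =
      ∑ S ∈ zsfFinset n l, p ^ S.toFinset.card := by
  have : IsProbabilityMeasure (productMeasure n p) := by
    rw [productMeasure_eq]; infer_instance
  simp_rw [NRcount_eq]
  rw [integral_finsetSum]
  · refine Finset.sum_congr rfl fun S _ => ?_
    rw [← measure_contains hp]
    exact integral_indicator_one (Set.toFinite _).measurableSet
  · intro S _
    exact (integrable_const _).indicator (Set.toFinite _).measurableSet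

/-- For fixed `k`, `E(N^R_{n-1-k}) = p·φ(n)·(1 + O_k(p))`. -/
theorem expectation_NRcount_asymp (k : ℕ) :
    ∃ C : ℝ, 0 < C ∧ ∀ n : ℕ, 2 ≤ n → k ≤ n / 3 → ∀ p ∈ Set.Icc (0 : ℝ) 1,
      |(∫ f, (NRcount n (n - 1 - k) f : ℝ) ∂(productMeasure n p))
          - p * (Nat.totient n : ℝ)| ≤ C * p ^ 2 * (Nat.totient n : ℝ) := by
  classical
  let c : ℕ → ℕ := fun n => if h : n = 0 then 0 else
    haveI : NeZero n := ⟨h⟩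
    (zsfFinset n (n - 1 - k)).card
  let C : ℕ := 1 + Fintype.card (Sym (Fin (3 * k + 1)) (2 * k)) + ∑ n ∈ Finset.range (6 * k + 2), c n
  refine ⟨C, by simp only [C]; positivity, ?_⟩
  intro n hn hk p hp
  have : NeZero n := ⟨by omega⟩
  have hcard : (zsfFinset n (n - 1 - k)).card ≤ C * Nat.totient n := by
    have hpos : 1 ≤ Nat.totient n := Nat.totient_pos.2 (by omega)
    by_cases hb : 6 * k + 2 ≤ n
    · refine (card_zsf_large hb).trans ?_
      rw [mul_comm]
      apply Nat.mul_le_mul_right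
      simp only [C]; omega
    · have h1 : c n ≤ ∑ n ∈ Finset.range (6 * k + 2), c n :=
        Finset.single_le_sum (f := c) (fun _ _ => Nat.zero_le _) (Finset.mem_range.2 (by omega))
      have h2 : c n = (zsfFinset n (n - 1 - k)).card := by
        simp only [c]
        rw [dif_neg (by omega)]
      rw [← h2]
      calc c n ≤ C := by simp only [C]; omega
        _ ≤ C * Nat.totient n := Nat.le_mul_of_pos_right _ hpos
  rw [integral_eq _ hp]
  have hs := card_zsf_single (n := n) (l := n - 1 - k) (by omega) (by omega) (by omega)
  rw [← Finset.sum_filter_add_sum_filter_not _ (fun S => S.toFinset.card = 1)]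
  have e1 : ∑ S ∈ (zsfFinset n (n - 1 - k)).filter (fun S => S.toFinset.card = 1),
      p ^ S.toFinset.card = p * (Nat.totient n : ℝ) := by
    rw [← hs, mul_comm, ← nsmul_eq_mul]
    apply Finset.sum_eq_card_nsmul
    intro S hS
    rw [(Finset.mem_filter.1 hS).2, pow_one]
  rw [e1, add_sub_cancel_left, abs_of_nonneg (Finset.sum_nonneg fun _ _ => pow_nonneg hp.1 _)]
  calc _ ≤ ∑ S ∈ (zsfFinset n (n - 1 - k)).filter (fun S => ¬ S.toFinset.card = 1), p ^ 2 := by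
        apply Finset.sum_le_sum
        intro S hS
        rw [Finset.mem_filter, mem_zsfFinset] at hS
        apply pow_le_pow_of_le_one hp.1 hp.2
        have : S.toFinset.card ≠ 0 := by
          intro h0
          have : S = 0 := by simpa using h0
          have := hS.1.1
          simp_all
          omega
        have := hS.2
        omega
    _ ≤ ((zsfFinset n (n - 1 - k)).card : ℝ) * p ^ 2 := by
        rw [Finset.sum_const, nsmul_eq_mul]
        gcongr
        exact Finset.filter_subset _ _
    _ ≤ ((C * Nat.totient n : ℕ) : ℝ) * p ^ 2 := by gcongr
    _ = _ := by push_cast; ring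
end

section
/- Let n ≥ 2, 0 ≤ k ≤ ⌊n/3⌋, and 2 ≤ d ≤ ⌊(1+√(1+8k))/2⌋. Then for every element a of C_n, the number of zero-sum free sequences of length n−1−k over C_n having exactly d distinct elements whose support contains a is at most X_{k,d−1} + k·(X_{k−1,d−1} + X_{k−1,d−2}). Moreover, for every a ∈ C_n, the number of zero-sum free sequences of length n−1−k over C_n having exactly one distinct element whose support contains a is at most 1. -/
open MeasureTheory Filter

/-! ### Subset sums -/

/-- All subset sums (including the empty one). -/
noncomputable def Sig {n : ℕ} (T : Multiset (ZMod n)) : Finset (ZMod n) :=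
  (T.powerset.map Multiset.sum).toFinset

lemma mem_Sig {n : ℕ} {T : Multiset (ZMod n)} {z : ZMod n} :
    z ∈ Sig T ↔ ∃ V, V ≤ T ∧ V.sum = z := by
  simp [Sig]

lemma zero_mem_Sig {n : ℕ} (T : Multiset (ZMod n)) : (0 : ZMod n) ∈ Sig T :=
  mem_Sig.2 ⟨0, Multiset.zero_le _, by simp⟩

lemma Sig_cons {n : ℕ} (x : ZMod n) (T : Multiset (ZMod n)) :
    Sig (x ::ₘ T) = Sig T ∪ (Sig T).image (fun a => x + a) := by
  ext z
  simp only [Sig, Multiset.powerset_cons, Multiset.map_add, Multiset.map_map, Multiset.mem_toFinset,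
    Multiset.mem_add, Finset.mem_union, Finset.mem_image, Multiset.mem_map, Function.comp,
    Multiset.sum_cons]
  constructor
  · rintro (h | ⟨a, ha, rfl⟩)
    · exact Or.inl h
    · exact Or.inr ⟨_, ⟨a, ha, rfl⟩, rfl⟩
  · rintro (h | ⟨_, ⟨a, ha, rfl⟩, rfl⟩)
    · exact Or.inl h
    · exact Or.inr ⟨a, ha, rfl⟩

lemma mem_Sig_cons {n : ℕ} {x z : ZMod n} {T : Multiset (ZMod n)} :
    z ∈ Sig (x ::ₘ T) ↔ z ∈ Sig T ∨ z - x ∈ Sig T := by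
  rw [Sig_cons]
  simp only [Finset.mem_union, Finset.mem_image]
  constructor
  · rintro (h | ⟨a, ha, rfl⟩)
    · exact Or.inl h
    · right; simpa using ha
  · rintro (h | h)
    · exact Or.inl h
    · exact Or.inr ⟨_, h, by ring⟩

lemma neg_not_mem_Sig {n : ℕ} {x : ZMod n} {T : Multiset (ZMod n)}
    (h : ZeroSumFree (x ::ₘ T)) : -x ∉ Sig T := by
  intro hx
  obtain ⟨V, hV, hs⟩ := mem_Sig.1 hx
  exact h (x ::ₘ V) ((Multiset.cons_le_cons_iff x).2 hV) (Multiset.cons_ne_zero) (by simp [hs])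

lemma Sig_mem_self {n : ℕ} {x : ZMod n} {T : Multiset (ZMod n)} (h : x ∈ T) : x ∈ Sig T :=
  mem_Sig.2 ⟨{x}, by simpa using h, by simp⟩

lemma ZeroSumFree.ne_zero {n : ℕ} {x : ZMod n} {T : Multiset (ZMod n)} (h : ZeroSumFree T)
    (hx : x ∈ T) : x ≠ 0 := by
  have := h {x} (by simpa using hx) (by simp)
  simpa using this

lemma card_image_add {n : ℕ} (x : ZMod n) (A : Finset (ZMod n)) :
    (A.image (fun a => x + a)).card = A.card :=
  Finset.card_image_of_injective _ (add_right_injective x)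

lemma card_Sig_cons {n : ℕ} {x : ZMod n} {T : Multiset (ZMod n)}
    (h : ZeroSumFree (x ::ₘ T)) : (Sig T).card + 1 ≤ (Sig (x ::ₘ T)).card := by
  by_contra hlt
  have hsub : Sig T ⊆ Sig (x ::ₘ T) := by rw [Sig_cons]; exact Finset.subset_union_left
  have heq : Sig T = Sig (x ::ₘ T) := Finset.eq_of_subset_of_card_le hsub (by omega)
  have h2 : (Sig T).image (fun a => x + a) ⊆ Sig T := by
    conv_rhs => rw [heq, Sig_cons]
    exact Finset.subset_union_right
  have h3 := Finset.eq_of_subset_of_card_le h2 (by rw [card_image_add])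
  have h0 := zero_mem_Sig T
  rw [← h3] at h0
  obtain ⟨a, ha, hax⟩ := Finset.mem_image.1 h0
  apply neg_not_mem_Sig h
  rwa [neg_eq_of_add_eq_zero_right hax]

lemma backward {n : ℕ} {x : ZMod n} {T : Multiset (ZMod n)}
    (h : ZeroSumFree (x ::ₘ T)) (hc : (Sig (x ::ₘ T)).card ≤ (Sig T).card + 1) :
    ∀ z ∈ Sig T, z ≠ 0 → z - x ∈ Sig T := by
  intro z hz hz0
  by_contra hzx
  have hx := neg_not_mem_Sig h
  have hsub : ({0, z} : Finset (ZMod n)) ⊆ Sig T \ (Sig T).image (fun a => x + a) := by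
    intro u hu
    simp only [Finset.mem_insert, Finset.mem_singleton] at hu
    simp only [Finset.mem_sdiff, Finset.mem_image, not_exists, not_and]
    rcases hu with rfl | rfl
    · exact ⟨zero_mem_Sig T, fun a ha hax => hx (by rwa [neg_eq_of_add_eq_zero_right hax])⟩
    · exact ⟨hz, fun a ha hax => hzx (by rw [← hax]; simpa using ha)⟩
  have h2 := Finset.card_le_card hsub
  rw [Finset.card_pair (Ne.symm hz0)] at h2
  have h3 := Finset.card_sdiff_add_card (Sig T) ((Sig T).image (fun a => x + a))
  rw [card_image_add, ← Sig_cons] at h3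
  omega

lemma self_mem_Sig {n : ℕ} {x : ZMod n} {T : Multiset (ZMod n)} (hT : T ≠ 0)
    (h : ZeroSumFree (x ::ₘ T)) (hc : (Sig (x ::ₘ T)).card ≤ (Sig T).card + 1) :
    x ∈ Sig T := by
  by_contra hx
  have hσ : T.sum ≠ 0 := h T (Multiset.le_cons_self _ _) hT
  have hσx : x + T.sum ∉ Sig T := by
    intro hm
    obtain ⟨V, hV, hs⟩ := mem_Sig.1 hm
    refine h (x ::ₘ (T - V)) ((Multiset.cons_le_cons_iff x).2 (Multiset.sub_le_self _ _))
      (Multiset.cons_ne_zero) ?_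
    have h1 : (T - V).sum + V.sum = T.sum := by
      rw [← Multiset.sum_add, Multiset.sub_add_cancel hV]
    rw [Multiset.sum_cons]
    rw [hs] at h1
    linear_combination h1
  have hsub : ({x, x + T.sum} : Finset (ZMod n)) ⊆ (Sig T).image (fun a => x + a) \ Sig T := by
    intro u hu
    simp only [Finset.mem_insert, Finset.mem_singleton] at hu
    simp only [Finset.mem_sdiff, Finset.mem_image]
    rcases hu with rfl | rfl
    · exact ⟨⟨0, zero_mem_Sig T, by simp⟩, hx⟩
    · exact ⟨⟨_, mem_Sig.2 ⟨T, le_rfl, rfl⟩, rfl⟩, hσx⟩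
  have h2 := Finset.card_le_card hsub
  rw [Finset.card_pair (by simpa using hσ)] at h2
  have h3 := Finset.card_sdiff_add_card ((Sig T).image (fun a => x + a)) (Sig T)
  rw [Finset.union_comm, ← Sig_cons] at h3
  omega

lemma one_term_unique {n : ℕ} {x y : ZMod n} {T : Multiset (ZMod n)} (hT : T ≠ 0)
    (h : ZeroSumFree (x ::ₘ T)) (hc : (Sig (x ::ₘ T)).card ≤ (Sig T).card + 1)
    (h' : ZeroSumFree (y ::ₘ T)) (hc' : (Sig (y ::ₘ T)).card ≤ (Sig T).card + 1) : x = y := by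
  by_contra hne
  have hx := self_mem_Sig hT h hc
  have h1 := backward h' hc' x hx (h.ne_zero (by simp))
  have h2 := backward h hc _ h1 (sub_ne_zero.2 hne)
  apply neg_not_mem_Sig h'
  convert h2 using 1
  ring

lemma backward_replicate {n : ℕ} {x : ZMod n} {T : Multiset (ZMod n)}
    (h : ∀ z ∈ Sig T, z ≠ 0 → z - x ∈ Sig T) (j : ℕ) :
    ∀ z ∈ Sig (T + Multiset.replicate j x), z ≠ 0 → z - x ∈ Sig (T + Multiset.replicate j x) := by
  induction j with
  | zero => simpa using h
  | succ j ih =>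
    intro z hz hz0
    rw [Multiset.replicate_succ, Multiset.add_cons, mem_Sig_cons] at hz ⊢
    left
    rcases hz with hz | hz
    · exact ih z hz hz0
    · exact hz

lemma card_Sig_replicate {n : ℕ} {x : ZMod n} {T : Multiset (ZMod n)} (j : ℕ)
    (h : ZeroSumFree (T + Multiset.replicate j x)) :
    (Sig T).card + j ≤ (Sig (T + Multiset.replicate j x)).card := by
  induction j with
  | zero => simp
  | succ j ih =>
    rw [Multiset.replicate_succ, Multiset.add_cons] at h ⊢
    have := ih (h.mono (Multiset.le_cons_self _ _))
    have := card_Sig_cons h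
    omega

lemma exists_peak {n : ℕ} {R T0 : Multiset (ZMod n)} (hR : ZeroSumFree R)
    (hc : (Sig R).card < 2 * Multiset.card R) (hT0 : T0 ≤ R)
    (h0 : 2 * Multiset.card T0 ≤ (Sig T0).card) :
    ∃ T x r, T0 ≤ T ∧ 1 ≤ r ∧ R = T + Multiset.replicate r x ∧
      2 * Multiset.card T ≤ (Sig T).card ∧
      (∀ z ∈ Sig T, z ≠ 0 → z - x ∈ Sig T) := by
  classical
  let F := R.powerset.toFinset.filter
    (fun T => T0 ≤ T ∧ 2 * Multiset.card T ≤ (Sig T).card)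
  have hmem : ∀ T, T ∈ F ↔ T ≤ R ∧ T0 ≤ T ∧ 2 * Multiset.card T ≤ (Sig T).card := by
    intro T; simp [F]
  obtain ⟨T, hTF, hmax⟩ := F.exists_max_image Multiset.card ⟨T0, (hmem _).2 ⟨hT0, le_rfl, h0⟩⟩
  obtain ⟨hTR, hT0T, hT2⟩ := (hmem T).1 hTF
  have key : ∀ u ∈ R - T, ZeroSumFree (u ::ₘ T) ∧
      (Sig (u ::ₘ T)).card ≤ 2 * Multiset.card T + 1 := by
    intro u hu
    have hle : u ::ₘ T ≤ R := by
      rw [← Multiset.singleton_add, ← Multiset.sub_add_cancel hTR]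
      exact add_le_add_left (by simpa using hu) T
    refine ⟨hR.mono hle, ?_⟩
    by_contra hcon
    have := hmax (u ::ₘ T) ((hmem _).2 ⟨hle, hT0T.trans (Multiset.le_cons_self _ _), by
      rw [Multiset.card_cons]; omega⟩)
    rw [Multiset.card_cons] at this
    omega
  have hne : R - T ≠ 0 := by
    intro h
    have : T = R := le_antisymm hTR (tsub_eq_zero_iff_le.1 h)
    subst this
    omega
  obtain ⟨x, hx⟩ := Multiset.exists_mem_of_ne_zero hne
  have hT : T ≠ 0 := by
    rintro rfl
    have h1 := (key x hx)
    have h2 := card_Sig_cons h1.1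
    have h3 : 0 < (Sig (0 : Multiset (ZMod n))).card := Finset.card_pos.2 ⟨0, zero_mem_Sig _⟩
    have := h1.2
    simp only [Multiset.card_zero] at this
    omega
  have hall : ∀ u ∈ R - T, u = x := by
    intro u hu
    exact one_term_unique hT (key u hu).1 (by have := (key u hu).2; omega)
      (key x hx).1 (by have := (key x hx).2; omega)
  refine ⟨T, x, Multiset.card (R - T), hT0T, Multiset.card_pos.2 hne, ?_, hT2,
    backward (key x hx).1 (by have := (key x hx).2; omega)⟩
  rw [← Multiset.eq_replicate_card.2 hall, add_comm, Multiset.sub_add_cancel hTR]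

lemma mem_Sig_replicate {n : ℕ} {x z : ZMod n} {v : ℕ} :
    z ∈ Sig (Multiset.replicate v x) ↔ ∃ i ≤ v, z = i • x := by
  rw [mem_Sig]
  constructor
  · rintro ⟨V, hV, rfl⟩
    obtain ⟨i, hi, rfl⟩ := Multiset.le_replicate_iff.1 hV
    exact ⟨i, hi, by simp⟩
  · rintro ⟨i, hi, rfl⟩
    exact ⟨Multiset.replicate i x, Multiset.replicate_le_replicate x |>.2 hi, by simp⟩

lemma card_Sig_pair {n : ℕ} {x t : ZMod n} {v : ℕ}
    (h : ZeroSumFree (t ::ₘ Multiset.replicate v x)) (ht : ∀ c ≤ v, t ≠ c • x) :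
    2 * (v + 1) ≤ (Sig (t ::ₘ Multiset.replicate v x)).card := by
  have h1 := card_Sig_replicate (T := 0) (x := x) v
    (by rw [zero_add]; exact h.mono (Multiset.le_cons_self _ _))
  rw [zero_add] at h1
  have h3 : 0 < (Sig (0 : Multiset (ZMod n))).card := Finset.card_pos.2 ⟨0, zero_mem_Sig _⟩
  rw [Sig_cons, Finset.card_union_of_disjoint, card_image_add]
  · omega
  · rw [Finset.disjoint_left]
    intro z hz hz'
    obtain ⟨w, hw, rfl⟩ := Finset.mem_image.1 hz'
    obtain ⟨i, hi, rfl⟩ := mem_Sig_replicate.1 hw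
    obtain ⟨j, hj, hij⟩ := mem_Sig_replicate.1 hz
    rcases le_or_gt i j with hle | hlt
    · refine ht (j - i) (by omega) ?_
      obtain ⟨e, rfl⟩ := Nat.exists_eq_add_of_le hle
      rw [add_tsub_cancel_left]
      rw [add_smul] at hij
      linear_combination hij
    · apply neg_not_mem_Sig h
      refine mem_Sig_replicate.2 ⟨i - j, by omega, ?_⟩
      obtain ⟨e, rfl⟩ := Nat.exists_eq_add_of_le hlt.le
      rw [add_tsub_cancel_left]
      rw [add_smul] at hij
      linear_combination -hij

lemma interval_sums {n : ℕ} {x : ZMod n} {v : ℕ} (c : ZMod n → ℕ) (hn : 0 < addOrderOf x)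
    (V : Multiset (ZMod n)) (hc : ∀ t ∈ V, c t ≤ v ∧ t = c t • x)
    (hz : ZeroSumFree (V + Multiset.replicate v x)) :
    v + (V.map c).sum < addOrderOf x ∧
      ∀ i ≤ v + (V.map c).sum, i • x ∈ Sig (V + Multiset.replicate v x) := by
  induction V using Multiset.induction_on with
  | empty =>
    simp only [Multiset.map_zero, Multiset.sum_zero, add_zero, zero_add] at hz ⊢
    refine ⟨?_, fun i hi => mem_Sig_replicate.2 ⟨i, hi, rfl⟩⟩
    by_contra hcon
    refine hz (Multiset.replicate (addOrderOf x) x)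
      ((Multiset.replicate_le_replicate x).2 (by omega)) ?_ ?_
    · intro h
      have := congrArg Multiset.card h
      rw [Multiset.card_replicate, Multiset.card_zero] at this
      omega
    · simpa using addOrderOf_nsmul_eq_zero x
  | cons t V ih =>
    rw [Multiset.cons_add] at hz ⊢
    obtain ⟨h1, h2⟩ := ih (fun u hu => hc u (Multiset.mem_cons_of_mem hu))
      (hz.mono (Multiset.le_cons_self _ _))
    obtain ⟨hcv, ht⟩ := hc t (Multiset.mem_cons_self _ _)
    rw [Multiset.map_cons, Multiset.sum_cons]
    constructor
    · by_contra hcon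
      apply neg_not_mem_Sig hz
      have := h2 (addOrderOf x - c t) (by omega)
      convert this using 1
      have h3 : (addOrderOf x - c t) • x + c t • x = 0 := by
        rw [← add_smul, Nat.sub_add_cancel (by omega), addOrderOf_nsmul_eq_zero]
      rw [← ht] at h3
      linear_combination -h3
    · intro i hi
      rw [mem_Sig_cons]
      by_cases hiL : i ≤ v + (V.map c).sum
      · exact Or.inl (h2 i hiL)
      · right
        have := h2 (i - c t) (by omega)
        convert this using 1
        have h3 : (i - c t) • x + c t • x = i • x := by
          rw [← add_smul, Nat.sub_add_cancel (by omega)]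
        rw [← ht] at h3
        linear_combination -h3

/-- Structure of long zero-sum free sequences. -/
theorem long_structure {n : ℕ} [NeZero n] (S : Multiset (ZMod n)) (hz : ZeroSumFree S)
    (hl : n + 2 ≤ 2 * Multiset.card S) :
    ∃ w : ZMod n, IsUnit w ∧ (S.map fun s => (w * s).val).sum < n := by
  classical
  have hcardle : ∀ A : Finset (ZMod n), A.card ≤ n := fun A => by
    simpa [ZMod.card] using Finset.card_le_univ A
  obtain ⟨T, x, r, -, hr, hS, hT2, hback⟩ := exists_peak (T0 := 0) hz
    (by have := hcardle (Sig S); omega) (Multiset.zero_le _) (by simp)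
  have hr2 : 2 ≤ r := by
    have h1 := card_Sig_replicate (T := T) (x := x) r (hS ▸ hz)
    have h2 := hcardle (Sig (T + Multiset.replicate r x))
    have h3 := congrArg Multiset.card hS
    rw [Multiset.card_add, Multiset.card_replicate] at h3
    omega
  obtain ⟨r, rfl⟩ : ∃ q, r = q + 1 := ⟨r - 1, by omega⟩
  set R := T + Multiset.replicate r x with hRdef
  have hSR : S = x ::ₘ R := by rw [hS, Multiset.replicate_succ, Multiset.add_cons]
  have hzR : ZeroSumFree R := hz.mono (hSR ▸ Multiset.le_cons_self _ _)
  have hxR : x ∈ R := by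
    rw [hRdef]
    exact Multiset.mem_add.2 (Or.inr (Multiset.mem_replicate.2 ⟨by omega, rfl⟩))
  have hnx : -x ∉ Sig R := neg_not_mem_Sig (hSR ▸ hz)
  have hbR : ∀ z ∈ Sig R, z ≠ 0 → z - x ∈ Sig R := backward_replicate hback r
  clear_value R
  have hcR : (Sig R).card < 2 * Multiset.card R := by
    have h1 := card_Sig_cons (hSR ▸ hz)
    have h2 := hcardle (Sig (x ::ₘ R))
    have h3 := congrArg Multiset.card hSR
    rw [Multiset.card_cons] at h3
    omega
  have hall : ∀ t ∈ R, ∃ c ≤ R.count x, t = c • x := by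
    intro t ht
    by_contra hcon
    push Not at hcon
    have hv : 1 ≤ R.count x := Multiset.one_le_count_iff_mem.2 hxR
    have htx : t ≠ x := by simpa using hcon 1 hv
    have hle : t ::ₘ Multiset.replicate (R.count x) x ≤ R := by
      rw [Multiset.le_iff_count]
      intro u
      rw [Multiset.count_cons, Multiset.count_replicate]
      by_cases hux : u = x
      · subst hux; simp [Ne.symm htx]
      · by_cases hut : u = t
        · subst hut; simpa [Ne.symm hux] using Multiset.one_le_count_iff_mem.2 ht
        · simp [hut, Ne.symm hux]
    have h2 := card_Sig_pair (hzR.mono hle) hcon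
    obtain ⟨T1, y, r1, hT1, hr1, hR1, -, hback1⟩ := exists_peak hzR hcR hle (by simpa using h2)
    have hyx : y ≠ x := by
      rintro rfl
      have h3 := congrArg (Multiset.count y) hR1
      have h4 := Multiset.count_le_of_le y hT1
      rw [Multiset.count_add, Multiset.count_replicate_self] at h3
      rw [Multiset.count_cons, Multiset.count_replicate_self] at h4
      omega
    have hyR : y ∈ R := by
      rw [hR1]
      exact Multiset.mem_add.2 (Or.inr (Multiset.mem_replicate.2 ⟨by omega, rfl⟩))
    have hbR1 : ∀ z ∈ Sig R, z ≠ 0 → z - y ∈ Sig R := by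
      rw [hR1]; exact backward_replicate hback1 r1
    have h5 := hbR y (Sig_mem_self hyR) (hzR.ne_zero hyR)
    have h6 := hbR1 _ h5 (sub_ne_zero.2 hyx)
    apply hnx
    convert h6 using 1
    ring
  choose! c hc using hall
  set v := S.count x with hv
  set V := S.filter (fun t => ¬ t = x) with hV
  have hSV : V + Multiset.replicate v x = S := by
    rw [hV, hv, ← Multiset.filter_eq', add_comm]
    exact Multiset.filter_add_not _ _
  have hcV : ∀ t ∈ V, c t ≤ v ∧ t = c t • x := by
    intro t ht
    rw [hV, Multiset.mem_filter] at ht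
    have htR : t ∈ R := by
      have := ht.1
      rw [hSR, Multiset.mem_cons] at this
      exact this.resolve_left ht.2
    refine ⟨(hc t htR).1.trans ?_, (hc t htR).2⟩
    rw [hv, hSR]
    exact Multiset.count_le_of_le _ (Multiset.le_cons_self _ _)
  have hord : 0 < addOrderOf x := addOrderOf_pos x
  obtain ⟨hlt, -⟩ := interval_sums c hord V hcV (hSV ▸ hz)
  have hcpos : ∀ t ∈ V, 1 ≤ c t := by
    intro t ht
    rw [Nat.one_le_iff_ne_zero]
    intro h0
    have h1 := (hcV t ht).2
    rw [h0, zero_smul] at h1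
    exact hz.ne_zero (Multiset.mem_of_mem_filter ht) h1
  have hVc : Multiset.card V ≤ (V.map c).sum := by
    have := Multiset.card_nsmul_le_sum (s := V.map c) (a := 1) (by simpa using hcpos)
    simpa using this
  have hcardS : Multiset.card V + v = Multiset.card S := by
    rw [← hSV]; simp
  have hdvd : addOrderOf x ∣ n := by
    have := addOrderOf_dvd_card (x := x)
    rwa [ZMod.card] at this
  have hordn : addOrderOf x = n := by
    obtain ⟨q, hq⟩ := hdvd
    have hn := NeZero.ne n
    rcases q with _ | _ | q
    · simp at hq; omega
    · simpa using hq.symm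
    · exfalso
      have : addOrderOf x * 2 ≤ addOrderOf x * (q + 1 + 1) := Nat.mul_le_mul_left _ (by omega)
      omega
  have hux : IsUnit x := by
    have h1 : (1 : ZMod n) ∈ AddSubgroup.zmultiples x := by
      have htop : AddSubgroup.zmultiples x = ⊤ := by
        apply AddSubgroup.eq_top_of_card_eq
        rw [Nat.card_zmultiples, hordn, Nat.card_zmod]
      rw [htop]; trivial
    obtain ⟨q, hq⟩ := AddSubgroup.mem_zmultiples_iff.1 h1
    rw [zsmul_eq_mul] at hq
    exact IsUnit.of_mul_eq_one (q : ZMod n) (by rw [mul_comm]; exact hq)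
  obtain ⟨u, rfl⟩ := hux
  refine ⟨((u⁻¹ : (ZMod n)ˣ) : ZMod n), Units.isUnit _, ?_⟩
  have hval : ∀ t ∈ V, (((u⁻¹ : (ZMod n)ˣ) : ZMod n) * t).val = c t := by
    intro t ht
    obtain ⟨h1, h2⟩ := hcV t ht
    have : ((u⁻¹ : (ZMod n)ˣ) : ZMod n) * t = (c t : ZMod n) := by
      conv_lhs => rw [h2, nsmul_eq_mul]
      rw [mul_comm ((c t : ZMod n)), ← mul_assoc]; simp
    rw [this, ZMod.val_natCast, Nat.mod_eq_of_lt]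
    omega
  have h1v : ∀ m : ℕ, m % n ≤ m := fun m => Nat.mod_le _ _
  rw [← hSV, Multiset.map_add, Multiset.sum_add, Multiset.map_congr rfl hval,
    Multiset.map_replicate, Multiset.sum_replicate, Units.inv_mul, smul_eq_mul]
  have h11 : (1 : ZMod n).val ≤ 1 := by
    have := ZMod.val_natCast n 1
    rw [Nat.cast_one] at this
    rw [this]; exact Nat.mod_le _ _
  have := Nat.mul_le_mul_left v h11
  omega

/-! ### Partitions -/

/-- Partitions of integers at most `k` with `d` distinct part sizes, as multisets. -/
def PS (k d : ℕ) : Set (Multiset ℕ) :=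
  {l | (∀ i ∈ l, 0 < i) ∧ l.sum ≤ k ∧ l.toFinset.card = d}

lemma PS_bound (k d : ℕ) : (PS k d).Finite ∧ (PS k d).ncard ≤ X k d := by
  let Q := Σ j : Fin (k + 1), {p : Nat.Partition (j : ℕ) // p.parts.toFinset.card = d}
  let F : Q → Multiset ℕ := fun q => q.2.1.parts
  have hsub : PS k d ⊆ Set.image F Set.univ := by
    rintro l ⟨h1, h2, h3⟩
    exact ⟨⟨⟨l.sum, by omega⟩, ⟨⟨l, fun {i} hi => h1 i hi, rfl⟩, h3⟩⟩, trivial, rfl⟩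
  have hfin : (Set.image F Set.univ).Finite := Set.toFinite _
  refine ⟨hfin.subset hsub, (Set.ncard_le_ncard hsub hfin).trans ?_⟩
  refine (Set.ncard_image_le (Set.toFinite _)).trans ?_
  rw [Set.ncard_univ, Nat.card_sigma, X, Finset.sum_range]
  rfl

lemma PS_part_bound (k d y : ℕ) (hy : 1 ≤ y) :
    {l ∈ PS k d | y ∈ l}.ncard ≤ X (k - 1) d + X (k - 1) (d - 1) := by
  have hfin := (PS_bound (k - 1) d).1.union (PS_bound (k - 1) (d - 1)).1
  refine (Set.ncard_le_ncard_of_injOn (fun l => l.erase y) ?_ ?_ hfin).trans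
    ((Set.ncard_union_le _ _).trans (add_le_add (PS_bound _ _).2 (PS_bound _ _).2))
  · rintro l ⟨⟨h1, h2, h3⟩, hyl⟩
    obtain ⟨m, rfl⟩ := Multiset.exists_cons_of_mem hyl
    simp only [Multiset.erase_cons_head]
    have hp : ∀ i ∈ m, 0 < i := fun i hi => h1 i (Multiset.mem_cons_of_mem hi)
    have hs : m.sum ≤ k - 1 := by
      rw [Multiset.sum_cons] at h2; omega
    rw [Multiset.toFinset_cons] at h3
    by_cases hym : y ∈ m.toFinset
    · left
      rw [Finset.insert_eq_of_mem hym] at h3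
      exact ⟨hp, hs, h3⟩
    · right
      rw [Finset.card_insert_of_notMem hym] at h3
      exact ⟨hp, hs, by omega⟩
  · rintro l ⟨_, hyl⟩ l' ⟨_, hyl'⟩ h
    simp only at h
    rw [← Multiset.cons_erase hyl, h, Multiset.cons_erase hyl']

/-! ### Counting sequences with a fixed scaling -/

/-- The partition attached to a sequence and a scaling factor. -/
def toPart {n : ℕ} (w : ZMod n) (S : Multiset (ZMod n)) : Multiset ℕ :=
  (S.map fun s => (w * s).val - 1).filter (fun i => ¬ i = 0)

/-- Sequences through `a` that are small after scaling by `w`. -/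
def SW (n k d : ℕ) (a w : ZMod n) : Set (Multiset (ZMod n)) :=
  {S | Multiset.card S = n - 1 - k ∧ ZeroSumFree S ∧ S.toFinset.card = d ∧ a ∈ S ∧
    (S.map fun s => (w * s).val).sum < n}

lemma val_pos_of {n : ℕ} [NeZero n] {w s : ZMod n} (hw : IsUnit w) (hs : s ≠ 0) :
    1 ≤ (w * s).val := by
  rw [Nat.one_le_iff_ne_zero, Ne, ZMod.val_eq_zero, hw.mul_right_eq_zero]
  exact hs

lemma SW_sum {n k d : ℕ} [NeZero n] (hnk : 2 * k + 2 ≤ n) {a w : ZMod n} (hw : IsUnit w)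
    {S : Multiset (ZMod n)} (hS : S ∈ SW n k d a w) :
    (S.map fun s => (w * s).val - 1).sum ≤ k := by
  obtain ⟨hc, hz, hd, ha, hsum⟩ := hS
  have h1 : (S.map fun s => (w * s).val).sum
      = (S.map fun s => (w * s).val - 1).sum + Multiset.card S := by
    have : (S.map fun s => (w * s).val) = S.map fun s => ((w * s).val - 1) + 1 := by
      apply Multiset.map_congr rfl
      intro s hs
      have := val_pos_of hw (hz.ne_zero hs)
      omega
    rw [this, Multiset.sum_map_add]
    simp
  omega

lemma SW_a {n k d : ℕ} [NeZero n] (hnk : 2 * k + 2 ≤ n) {a w : ZMod n} (hw : IsUnit w)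
    {S : Multiset (ZMod n)} (hS : S ∈ SW n k d a w) :
    1 ≤ (w * a).val ∧ (w * a).val ≤ k + 1 := by
  have h1 := SW_sum hnk hw hS
  obtain ⟨hc, hz, hd, ha, hsum⟩ := hS
  have h2 := Multiset.le_sum_of_mem (Multiset.mem_map_of_mem (fun s => (w * s).val - 1) ha)
  have h3 := val_pos_of hw (hz.ne_zero ha)
  omega

lemma sum_filter_ne_zero (L : Multiset ℕ) : (L.filter (fun i => ¬ i = 0)).sum = L.sum := by
  have h := Multiset.filter_add_not (fun i => i = 0) L
  have h2 := congrArg Multiset.sum h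
  rw [Multiset.sum_add, Multiset.filter_eq', Multiset.sum_replicate] at h2
  simpa using h2

lemma toPart_mem {n k d : ℕ} [NeZero n] (hnk : 2 * k + 2 ≤ n) {a w : ZMod n} (hw : IsUnit w)
    {S : Multiset (ZMod n)} (hS : S ∈ SW n k d a w) : toPart w S ∈ PS k (d - 1) := by
  have h1 := SW_sum hnk hw hS
  obtain ⟨hc, hz, hd, ha, hsum⟩ := hS
  set L := S.map fun s => (w * s).val - 1 with hL
  have hLc : Multiset.card L = n - 1 - k := by rw [hL, Multiset.card_map, hc]
  have hpos : ∀ i ∈ L.filter (fun i => ¬ i = 0), 0 < i := by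
    intro i hi
    have := (Multiset.mem_filter.1 hi).2
    omega
  refine ⟨hpos, ?_, ?_⟩
  · rw [toPart, sum_filter_ne_zero]; exact h1
  · have h0 : 0 ∈ L := by
      by_contra h0
      have h2 := Multiset.card_nsmul_le_sum (s := L) (a := 1) (by
        intro i hi
        rcases Nat.eq_zero_or_pos i with rfl | h
        · exact absurd hi h0
        · exact h)
      rw [hLc, smul_eq_mul] at h2
      omega
    have hcard : L.toFinset.card = d := by
      rw [hL, Multiset.toFinset_map, Finset.card_image_of_injOn, hd]
      intro s hs t ht hst
      simp only [Finset.mem_coe, Multiset.mem_toFinset] at hs ht hst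
      have e1 := val_pos_of hw (hz.ne_zero hs)
      have e2 := val_pos_of hw (hz.ne_zero ht)
      exact hw.mul_left_cancel (ZMod.val_injective n (by omega))
    have hE : (toPart w S).toFinset = L.toFinset.erase 0 := by
      ext i
      simp only [toPart, Multiset.mem_toFinset, Multiset.mem_filter, Finset.mem_erase, ← hL]
      tauto
    rw [hE, Finset.card_erase_of_mem (Multiset.mem_toFinset.2 h0), hcard]

lemma toPart_a {n k d : ℕ} {a w : ZMod n}
    {S : Multiset (ZMod n)} (hS : S ∈ SW n k d a w) (h2 : 2 ≤ (w * a).val) :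
    (w * a).val - 1 ∈ toPart w S := by
  obtain ⟨hc, hz, hd, ha, hsum⟩ := hS
  exact Multiset.mem_filter.2 ⟨Multiset.mem_map_of_mem (fun s => (w * s).val - 1) ha, by omega⟩

lemma toPart_injOn {n k d : ℕ} [NeZero n] {a w : ZMod n} (hw : IsUnit w) :
    Set.InjOn (toPart w) (SW n k d a w) := by
  have hrec : ∀ S ∈ SW n k d a w, ∃ u : ZMod n,
      u * w = 1 ∧ S = (S.map fun s => (w * s).val - 1).map fun m : ℕ => (↑hw.unit⁻¹ : ZMod n) * ((m : ZMod n) + 1) := by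
    rintro S ⟨hc, hz, hd, ha, hsum⟩
    refine ⟨↑hw.unit⁻¹, by simp, ?_⟩
    rw [Multiset.map_map]
    conv_lhs => rw [← Multiset.map_id S]
    apply Multiset.map_congr rfl
    intro s hs
    have h1 := val_pos_of hw (hz.ne_zero hs)
    have h2 : (((w * s).val - 1 : ℕ) : ZMod n) + 1 = w * s := by
      rw [Nat.cast_sub h1, Nat.cast_one, sub_add_cancel, ZMod.natCast_zmod_val]
    simp only [Function.comp, id, h2, ← mul_assoc]
    simp
  have hL : ∀ S ∈ SW n k d a w, (S.map fun s => (w * s).val - 1)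
      = Multiset.replicate (n - 1 - k - Multiset.card (toPart w S)) 0 + toPart w S := by
    rintro S ⟨hc, hz, hd, ha, hsum⟩
    have h := Multiset.filter_add_not (fun i => i = 0) (S.map fun s => (w * s).val - 1)
    have h2 := congrArg Multiset.card h
    rw [Multiset.filter_eq'] at h h2
    rw [Multiset.card_add, Multiset.card_replicate, Multiset.card_map, hc] at h2
    conv_lhs => rw [← h]
    rw [toPart]
    congr 2
    omega
  intro S hS S' hS' h
  obtain ⟨_, _, e1⟩ := hrec S hS
  obtain ⟨_, _, e2⟩ := hrec S' hS'
  rw [e1, e2, hL S hS, hL S' hS', h]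

lemma SW_bound1 {n k d : ℕ} [NeZero n] (hnk : 2 * k + 2 ≤ n) {a w : ZMod n} (hw : IsUnit w) :
    (SW n k d a w).Finite ∧ (SW n k d a w).ncard ≤ X k (d - 1) := by
  have hm : Set.MapsTo (toPart w) (SW n k d a w) (PS k (d - 1)) :=
    fun S hS => toPart_mem hnk hw hS
  exact ⟨Set.Finite.of_injOn hm (toPart_injOn hw) (PS_bound _ _).1,
    (Set.ncard_le_ncard_of_injOn _ hm (toPart_injOn hw) (PS_bound _ _).1).trans (PS_bound _ _).2⟩

lemma SW_bound2 {n k d : ℕ} [NeZero n] (hnk : 2 * k + 2 ≤ n) {a w : ZMod n} (hw : IsUnit w)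
    (h2 : 2 ≤ (w * a).val) :
    (SW n k d a w).ncard ≤ X (k - 1) (d - 1) + X (k - 1) (d - 2) := by
  refine (Set.ncard_le_ncard_of_injOn (t := {l ∈ PS k (d - 1) | (w * a).val - 1 ∈ l}) (toPart w)
    (fun S hS => ⟨toPart_mem hnk hw hS, toPart_a hS h2⟩) (toPart_injOn hw)
    ((PS_bound _ _).1.subset (Set.sep_subset _ _))).trans ?_
  exact PS_part_bound k (d - 1) _ (by omega)

/-! ### Counting scalings -/

lemma card_scalings {n : ℕ} [NeZero n] (k : ℕ) (a : ZMod n) :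
    (Finset.univ.filter fun w : ZMod n => 1 ≤ (w * a).val ∧ (w * a).val ≤ k + 1).card ≤ k + 1 := by
  classical
  set e := Nat.gcd a.val n with he
  have hepos : 0 < e := Nat.gcd_pos_of_pos_right _ (Nat.pos_of_ne_zero (NeZero.ne n))
  have hmain := Finset.card_le_mul_card_image_of_maps_to
    (s := Finset.univ.filter fun w : ZMod n => 1 ≤ (w * a).val ∧ (w * a).val ≤ k + 1)
    (t := (Finset.Ioc 0 (k + 1)).filter (e ∣ ·)) (f := fun w => (w * a).val)
    (by
      intro w hw
      simp only [Finset.mem_filter, Finset.mem_univ, true_and] at hw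
      simp only [Finset.mem_filter, Finset.mem_Ioc]
      refine ⟨by omega, ?_⟩
      rw [ZMod.val_mul]
      exact (Nat.dvd_mod_iff (Nat.gcd_dvd_right _ _)).2
        (Dvd.dvd.mul_left (Nat.gcd_dvd_left _ _) _)) e
    (by
      intro b _
      rcases Finset.eq_empty_or_nonempty (Finset.filter (fun w => (w * a).val = b)
        (Finset.univ.filter fun w : ZMod n => 1 ≤ (w * a).val ∧ (w * a).val ≤ k + 1)) with h | ⟨w0, hw0⟩
      · rw [h]; simp
      · have hw0' := (Finset.mem_filter.1 hw0).2
        have hcyc := IsAddCyclic.card_nsmul_eq_zero_le (α := ZMod n) hepos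
        refine le_trans (Finset.card_le_card_of_injOn (fun w => w - w0) ?_ ?_) hcyc
        · intro w hw
          have hw' := (Finset.mem_filter.1 hw).2
          have hz : (w - w0) * a = 0 := by
            rw [sub_mul, sub_eq_zero]
            exact ZMod.val_injective n (by rw [hw', hw0'])
          have hbez : (e : ZMod n) = a * ((Nat.gcdA a.val n : ℤ) : ZMod n) := by
            have h := congrArg (fun z : ℤ => (z : ZMod n)) (Nat.gcd_eq_gcd_ab a.val n)
            push_cast at h
            rw [ZMod.natCast_zmod_val, ZMod.natCast_self] at h
            simpa using h
          simp only [Finset.coe_filter, Finset.mem_univ, true_and, Set.mem_ofPred_eq]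
          rw [nsmul_eq_mul, hbez]
          linear_combination ((Nat.gcdA a.val n : ℤ) : ZMod n) * hz
        · intro w _ w' _ h
          simpa using h)
  rw [Nat.Ioc_filter_dvd_card_eq_div] at hmain
  exact hmain.trans (Nat.mul_div_le _ _)

theorem count_of_structure {n k d : ℕ} [NeZero n] (hnk : 2 * k + 2 ≤ n) (a : ZMod n)
    (hstr : ∀ S : Multiset (ZMod n), Multiset.card S = n - 1 - k → ZeroSumFree S →
      ∃ w : ZMod n, IsUnit w ∧ (S.map fun s => (w * s).val).sum < n) :
    Nat.card {S : Multiset (ZMod n) //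
        Multiset.card S = n - 1 - k ∧ ZeroSumFree S ∧ S.toFinset.card = d ∧ a ∈ S}
      ≤ X k (d - 1) + k * (X (k - 1) (d - 1) + X (k - 1) (d - 2)) := by
  classical
  let W := (Finset.univ.filter fun w : ZMod n =>
    (1 ≤ (w * a).val ∧ (w * a).val ≤ k + 1)).filter (fun w => IsUnit w)
  have hWmem : ∀ w, w ∈ W ↔ (1 ≤ (w * a).val ∧ (w * a).val ≤ k + 1) ∧ IsUnit w := by
    intro w; simp [W]
  have hWc : W.card ≤ k + 1 := (Finset.card_filter_le _ _).trans (card_scalings k a)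
  have hsub : {S : Multiset (ZMod n) |
        Multiset.card S = n - 1 - k ∧ ZeroSumFree S ∧ S.toFinset.card = d ∧ a ∈ S}
      ⊆ ⋃ w ∈ W, SW n k d a w := by
    rintro S ⟨h1, h2, h3, h4⟩
    obtain ⟨w, hw, hs⟩ := hstr S h1 h2
    have hS : S ∈ SW n k d a w := ⟨h1, h2, h3, h4, hs⟩
    simp only [Set.mem_iUnion]
    exact ⟨w, (hWmem w).2 ⟨SW_a hnk hw hS, hw⟩, hS⟩
  have hfin : (⋃ w ∈ W, SW n k d a w).Finite :=
    Set.Finite.biUnion W.finite_toSet (fun w hw => (SW_bound1 hnk ((hWmem w).1 hw).2).1)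
  have h1 := (Set.ncard_le_ncard hsub hfin).trans (Finset.set_ncard_biUnion_le W _)
  refine le_trans (le_of_eq ?_) (h1.trans ?_)
  · exact Nat.card_coe_set_eq _
  · rcases W.eq_empty_or_nonempty with hW | hW
    · rw [hW]; simp
    · have hw0 : ∃ w0 ∈ W, ∀ w ∈ W, w ≠ w0 → 2 ≤ (w * a).val := by
        by_cases hex : ∃ w0 ∈ W, (w0 * a).val = 1
        · obtain ⟨w0, hw0, hv0⟩ := hex
          refine ⟨w0, hw0, fun w hw hne => ?_⟩
          by_contra hlt
          have hv : (w * a).val = 1 := by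
            have := ((hWmem w).1 hw).1.1
            omega
          have e0 : w0 * a = 1 := by
            rw [← ZMod.natCast_zmod_val (w0 * a), hv0, Nat.cast_one]
          have e1 : w * a = 1 := by
            rw [← ZMod.natCast_zmod_val (w * a), hv, Nat.cast_one]
          apply hne
          linear_combination w0 * e1 - w * e0
        · push Not at hex
          obtain ⟨w0, hw0⟩ := hW
          refine ⟨w0, hw0, fun w hw _ => ?_⟩
          have := ((hWmem w).1 hw).1.1
          have := hex w hw
          omega
      obtain ⟨w0, hw0, hoth⟩ := hw0
      rw [← Finset.add_sum_erase W _ hw0]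
      refine add_le_add (SW_bound1 hnk ((hWmem w0).1 hw0).2).2 ?_
      refine (Finset.sum_le_card_nsmul _ _ (X (k - 1) (d - 1) + X (k - 1) (d - 2)) ?_).trans ?_
      · intro w hw
        rw [Finset.mem_erase] at hw
        exact SW_bound2 hnk ((hWmem w).1 hw.2).2 (hoth w hw.2 hw.1)
      · rw [Finset.card_erase_of_mem hw0, smul_eq_mul]
        exact Nat.mul_le_mul_right _ (by omega)

/-! ### Small cases of the structure theorem -/

/-- Subset sums of a list. -/
def sumsL {n : ℕ} : List (ZMod n) → List (ZMod n)
  | [] => [0]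
  | x :: l => sumsL l ++ (sumsL l).map (fun a => x + a)

/-- Boolean test for zero-sum freeness. -/
def zfB {n : ℕ} : List (ZMod n) → Bool
  | [] => true
  | x :: l => zfB l && !(decide (-x ∈ sumsL l))

/-- Boolean test for the conclusion of the structure theorem. -/
def goodB {n : ℕ} (l : List (ZMod n)) (w : ZMod n) : Bool :=
  decide ((l.map fun s => (w * s).val).sum < n)

lemma mem_sumsL {n : ℕ} (l : List (ZMod n)) (z : ZMod n) (h : z ∈ sumsL l) :
    z ∈ Sig (l : Multiset (ZMod n)) := by
  induction l generalizing z with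
  | nil =>
    simp only [sumsL, List.mem_singleton] at h
    subst h; exact zero_mem_Sig _
  | cons x l ih =>
    simp only [sumsL, List.mem_append, List.mem_map] at h
    rw [← Multiset.cons_coe, mem_Sig_cons]
    rcases h with h | ⟨a, ha, rfl⟩
    · exact Or.inl (ih z h)
    · right; simpa using ih a ha

lemma zfB_of {n : ℕ} (l : List (ZMod n)) (h : ZeroSumFree (l : Multiset (ZMod n))) :
    zfB l = true := by
  induction l with
  | nil => rfl
  | cons x l ih =>
    rw [← Multiset.cons_coe] at h
    simp only [zfB, Bool.and_eq_true, Bool.not_eq_true', decide_eq_false_iff_not]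
    exact ⟨ih (h.mono (Multiset.le_cons_self _ _)), fun hm => neg_not_mem_Sig h (mem_sumsL _ _ hm)⟩

lemma small4 : ∀ a b : ZMod 4, zfB [a, b] = true →
    ∃ w : ZMod 4, (∃ u, w * u = 1) ∧ goodB [a, b] w = true := by
  decide +kernel

lemma small5 : ∀ g a : ZMod 5, zfB [a, g, g] = true →
    ∃ w : ZMod 5, (∃ u, w * u = 1) ∧ goodB [a, g, g] w = true := by
  decide +kernel

lemma small7 : ∀ g : ZMod 7, zfB [g, g] = true → ∀ a, zfB [a, g, g] = true →
    ∀ b, zfB [b, a, g, g] = true →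
    ∃ w : ZMod 7, (∃ u, w * u = 1) ∧ goodB [b, a, g, g] w = true := by
  decide +kernel

lemma small9 : ∀ g : ZMod 9, zfB [g, g] = true → ∀ a, zfB [a, g, g] = true →
    ∀ b, zfB [b, a, g, g] = true → ∀ c, zfB [c, b, a, g, g] = true →
    ∃ w : ZMod 9, (∃ u, w * u = 1) ∧ goodB [c, b, a, g, g] w = true := by
  decide +kernel

lemma exists_repeat {n : ℕ} [NeZero n] (hodd : Odd n) (S : Multiset (ZMod n))
    (hz : ZeroSumFree S) (hl : n < 2 * Multiset.card S) : ∃ g U, S = U + {g, g} := by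
  classical
  by_cases hnd : S.Nodup
  · exfalso
    have hdis : Disjoint S.toFinset (S.toFinset.image (fun s => -s)) := by
      rw [Finset.disjoint_left]
      intro z hzS hz'
      obtain ⟨s, hs, rfl⟩ := Finset.mem_image.1 hz'
      rw [Multiset.mem_toFinset] at hs hzS
      have hs0 := hz.ne_zero hs
      have hne : s ≠ -s := fun h => ZMod.ne_neg_self hodd hs0 h
      refine hz (s ::ₘ {-s}) ?_ (by simp) (by simp)
      rw [Multiset.le_iff_subset (by simpa using hne)]
      intro u hu
      simp only [Multiset.mem_cons, Multiset.mem_singleton] at hu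
      rcases hu with rfl | rfl <;> assumption
    have h1 := Finset.card_union_of_disjoint hdis
    rw [Finset.card_image_of_injective _ neg_injective,
      Multiset.toFinset_card_of_nodup hnd] at h1
    have h2 := Finset.card_le_univ (S.toFinset ∪ S.toFinset.image (fun s => -s))
    rw [ZMod.card] at h2
    omega
  · rw [Multiset.nodup_iff_le] at hnd
    push Not at hnd
    obtain ⟨g, hg⟩ := hnd
    exact ⟨g, S - {g, g}, (Multiset.sub_add_cancel hg).symm⟩

lemma good_finish {n : ℕ} (l : List (ZMod n))
    (h : ∃ w : ZMod n, (∃ u, w * u = 1) ∧ goodB l w = true) :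
    ∃ w : ZMod n, IsUnit w ∧ ((l : Multiset (ZMod n)).map fun s => (w * s).val).sum < n := by
  obtain ⟨w, ⟨u, hu⟩, hg⟩ := h
  refine ⟨w, IsUnit.of_mul_eq_one u hu, ?_⟩
  simpa [goodB] using hg

lemma struct4 (S : Multiset (ZMod 4)) (hc : Multiset.card S = 2) (hz : ZeroSumFree S) :
    ∃ w : ZMod 4, IsUnit w ∧ (S.map fun s => (w * s).val).sum < 4 := by
  obtain ⟨a, b, rfl⟩ := Multiset.card_eq_two.1 hc
  exact good_finish [a, b] (small4 a b (zfB_of [a, b] hz))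

lemma struct5 (S : Multiset (ZMod 5)) (hc : Multiset.card S = 3) (hz : ZeroSumFree S) :
    ∃ w : ZMod 5, IsUnit w ∧ (S.map fun s => (w * s).val).sum < 5 := by
  obtain ⟨g, U, rfl⟩ := exists_repeat (by decide) S hz (by omega)
  obtain ⟨a, rfl⟩ := (Multiset.card_eq_one (s := U)).1 (by simpa using hc)
  exact good_finish [a, g, g] (small5 g a (zfB_of [a, g, g] hz))

lemma zfB_tail {n : ℕ} {x : ZMod n} {l : List (ZMod n)} (h : zfB (x :: l) = true) :
    zfB l = true := by
  simp only [zfB, Bool.and_eq_true] at h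
  exact h.1

lemma struct7 (S : Multiset (ZMod 7)) (hc : Multiset.card S = 4) (hz : ZeroSumFree S) :
    ∃ w : ZMod 7, IsUnit w ∧ (S.map fun s => (w * s).val).sum < 7 := by
  obtain ⟨g, U, rfl⟩ := exists_repeat (by decide) S hz (by omega)
  obtain ⟨b, a, rfl⟩ := (Multiset.card_eq_two (s := U)).1 (by simpa using hc)
  have h := zfB_of [b, a, g, g] hz
  have h1 := zfB_tail h
  exact good_finish [b, a, g, g] (small7 g (zfB_tail h1) a h1 b h)

lemma struct9 (S : Multiset (ZMod 9)) (hc : Multiset.card S = 5) (hz : ZeroSumFree S) :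
    ∃ w : ZMod 9, IsUnit w ∧ (S.map fun s => (w * s).val).sum < 9 := by
  obtain ⟨g, U, rfl⟩ := exists_repeat (by decide) S hz (by omega)
  obtain ⟨c, b, a, rfl⟩ := (Multiset.card_eq_three (s := U)).1 (by simpa using hc)
  have h := zfB_of [c, b, a, g, g] hz
  have h1 := zfB_tail h
  have h2 := zfB_tail h1
  exact good_finish [c, b, a, g, g] (small9 g (zfB_tail h2) a h2 b h1 c h)

/-! ### The exceptional case `n = 6`, `k = 2` -/

lemma X_values : 3 ≤ X 2 1 ∧ 1 ≤ X 1 1 ∧ 1 ≤ X 1 0 := by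
  have h0 : 1 ≤ numPartsDistinct 0 0 := by
    haveI : Nonempty {l : Nat.Partition 0 // l.parts.toFinset.card = 0} :=
      ⟨⟨⟨0, by simp, by simp⟩, by simp⟩⟩
    exact Nat.card_pos
  have h1 : 1 ≤ numPartsDistinct 1 1 := by
    haveI : Nonempty {l : Nat.Partition 1 // l.parts.toFinset.card = 1} :=
      ⟨⟨⟨{1}, by simp, by simp⟩, by simp⟩⟩
    exact Nat.card_pos
  have h2 : 1 < numPartsDistinct 2 1 := by
    haveI : Nontrivial {l : Nat.Partition 2 // l.parts.toFinset.card = 1} := by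
      refine ⟨⟨⟨{2}, by simp, by simp⟩, by simp⟩, ⟨⟨{1, 1}, by simp, by simp⟩, by simp⟩, ?_⟩
      intro h
      have := congrArg (fun p => Multiset.card p.1.parts) h
      simp at this
    exact Finite.one_lt_card
  simp only [X, Finset.sum_range_succ, Finset.sum_range_zero]
  omega

lemma six_card : ∀ a : ZMod 6,
    (((Finset.univ : Finset (ZMod 6 × ZMod 6)).filter (fun p => zfB [a, p.1, p.2] = true ∧
      ([a, p.1, p.2] : List (ZMod 6)).toFinset.card = 2)).image
        (fun p => (([a, p.1, p.2] : List (ZMod 6)) : Multiset (ZMod 6)))).card ≤ 7 := by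
  decide +kernel

lemma six_case (a : ZMod 6) :
    Nat.card {S : Multiset (ZMod 6) //
        Multiset.card S = 3 ∧ ZeroSumFree S ∧ S.toFinset.card = 2 ∧ a ∈ S} ≤ 7 := by
  refine le_trans ?_ (six_card a)
  rw [← Set.ncard_coe_finset]
  refine le_trans (le_of_eq (Nat.card_coe_set_eq {S : Multiset (ZMod 6) |
        Multiset.card S = 3 ∧ ZeroSumFree S ∧ S.toFinset.card = 2 ∧ a ∈ S}))
    (Set.ncard_le_ncard ?_ (Finset.finite_toSet _))
  rintro S ⟨h1, h2, h3, h4⟩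
  obtain ⟨T, rfl⟩ := Multiset.exists_cons_of_mem h4
  obtain ⟨b, c, rfl⟩ := (Multiset.card_eq_two (s := T)).1 (by simpa using h1)
  simp only [Finset.coe_image, Set.mem_image, Finset.mem_coe, Finset.mem_filter, Finset.mem_univ,
    true_and]
  exact ⟨(b, c), ⟨zfB_of [a, b, c] h2, h3⟩, rfl⟩

lemma Dk_lt (k m : ℕ) (h : 1 + 8 * k < (2 * m + 1) ^ 2) : Dk k < m + 1 := by
  unfold Dk
  rw [Nat.floor_lt (by positivity)]
  have h1 : Real.sqrt (1 + 8 * (k : ℝ)) < 2 * m + 1 := by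
    rw [Real.sqrt_lt' (by positivity)]
    exact_mod_cast h
  push_cast
  linarith

/-- Bound on the number of zero-sum free sequences of length `n-1-k` with `d` distinct
elements whose support contains a given element `a`. -/
theorem count_through_one_element (n k d : ℕ) (hn : 2 ≤ n) (hk : k ≤ n / 3)
    (hd2 : 2 ≤ d) (hdD : d ≤ Dk k) (a : ZMod n) :
    (Nat.card {S : Multiset (ZMod n) //
        Multiset.card S = n - 1 - k ∧ ZeroSumFree S ∧ S.toFinset.card = d ∧ a ∈ S}
      ≤ X k (d - 1) + k * (X (k - 1) (d - 1) + X (k - 1) (d - 2))) ∧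
    (Nat.card {S : Multiset (ZMod n) //
        Multiset.card S = n - 1 - k ∧ ZeroSumFree S ∧ S.toFinset.card = 1 ∧ a ∈ S}
      ≤ 1) := by
  have : NeZero n := ⟨by omega⟩
  constructor
  · have hk0 : k ≠ 0 := by
      rintro rfl
      have := Dk_lt 0 1 (by norm_num)
      omega
    have h3 : 3 * k ≤ n := by omega
    by_cases hmain : 2 * k + 4 ≤ n
    · refine count_of_structure (by omega) a ?_
      intro S hc hz
      exact long_structure S hz (by omega)
    · have hcases : (n = 3 ∧ k = 1) ∨ (n = 4 ∧ k = 1) ∨ (n = 5 ∧ k = 1) ∨ (n = 6 ∧ k = 2) ∨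
          (n = 7 ∧ k = 2) ∨ (n = 9 ∧ k = 3) := by omega
      rcases hcases with ⟨rfl, rfl⟩ | ⟨rfl, rfl⟩ | ⟨rfl, rfl⟩ | ⟨rfl, rfl⟩ | ⟨rfl, rfl⟩ | ⟨rfl, rfl⟩
      · have hempty : IsEmpty {S : Multiset (ZMod 3) //
            Multiset.card S = 3 - 1 - 1 ∧ ZeroSumFree S ∧ S.toFinset.card = d ∧ a ∈ S} := by
          refine ⟨?_⟩
          rintro ⟨S, h1, _, h2, _⟩
          have := Multiset.toFinset_card_le S
          omega
        rw [Nat.card_of_isEmpty]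
        exact Nat.zero_le _
      · exact count_of_structure (by omega) a struct4
      · exact count_of_structure (by omega) a struct5
      · have := Dk_lt 2 2 (by norm_num)
        obtain rfl : d = 2 := by omega
        obtain ⟨e1, e2, e3⟩ := X_values
        refine (six_case a).trans ?_
        simp only [Nat.reduceSub]
        omega
      · exact count_of_structure (by omega) a struct7
      · exact count_of_structure (by omega) a struct9
  · have hsub : Subsingleton {S : Multiset (ZMod n) //
        Multiset.card S = n - 1 - k ∧ ZeroSumFree S ∧ S.toFinset.card = 1 ∧ a ∈ S} := by
      have key : ∀ S : Multiset (ZMod n), Multiset.card S = n - 1 - k → S.toFinset.card = 1 →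
          a ∈ S → S = Multiset.replicate (n - 1 - k) a := by
        intro S h1 h2 h3
        rw [Multiset.eq_replicate]
        refine ⟨h1, fun b hb => ?_⟩
        exact Finset.card_le_one.1 h2.le b (Multiset.mem_toFinset.2 hb) a
          (Multiset.mem_toFinset.2 h3)
      refine ⟨?_⟩
      rintro ⟨S, h1, _, h2, h3⟩ ⟨S', h1', _, h2', h3'⟩
      exact Subtype.ext ((key S h1 h2 h3).trans (key S' h1' h2' h3').symm)
    exact Finite.card_le_one_iff_subsingleton.2 hsub
end

section
/- Let k : ℕ → ℕ satisfy 0 ≤ k(n) ≤ ⌊n/3⌋ for all n ≥ 2, let p : ℕ → [0,1] satisfy p(n)·n / log log n → ∞ as n → ∞, and let ω : ℕ → ℝ be any function with ω(n) → ∞ as n → ∞. Then the probability (with respect to the random subset R of C_n with inclusion probability p(n)) of the event p(n)·φ(n) − ω(n)·√(p(n)·φ(n)) ≤ N^R_{n−1−k(n),1} ≤ p(n)·φ(n) + ω(n)·√(p(n)·φ(n)) tends to 1 as n → ∞. -/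
open MeasureTheory Filter

lemma zsf_replicate_iff {n ℓ : ℕ} (hn : 0 < n) (h1 : ℓ < n) (h2 : n ≤ 2 * ℓ) (a : ZMod n) :
    ZeroSumFree (Multiset.replicate ℓ a) ↔ addOrderOf a = n := by
  haveI : NeZero n := ⟨hn.ne'⟩
  have hdvd : addOrderOf a ∣ n := by
    have := addOrderOf_dvd_card (x := a)
    rwa [ZMod.card] at this
  have hpos : 0 < addOrderOf a := addOrderOf_pos a
  constructor
  · intro h
    by_contra hne
    obtain ⟨c, hc⟩ := hdvd
    have hc2 : 2 ≤ c := by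
      rcases c with _ | _ | c
      · omega
      · simp at hc; omega
      · omega
    have hle : addOrderOf a ≤ ℓ := by
      have : addOrderOf a * 2 ≤ n := by
        conv_rhs => rw [hc]
        exact Nat.mul_le_mul_left _ hc2
      omega
    refine h (Multiset.replicate (addOrderOf a) a) ((Multiset.replicate_le_replicate a).2 hle) ?_ ?_
    · intro h0
      have := congrArg Multiset.card h0
      rw [Multiset.card_replicate, Multiset.card_zero] at this
      omega
    · rw [Multiset.sum_replicate, addOrderOf_nsmul_eq_zero]
  · intro h T hT hT0 hs
    obtain ⟨j, hj, rfl⟩ := Multiset.le_replicate_iff.1 hT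
    rw [Multiset.sum_replicate] at hs
    have hd := addOrderOf_dvd_of_nsmul_eq_zero hs
    rw [h] at hd
    have : j ≠ 0 := by
      rintro rfl
      simp at hT0
    have := Nat.le_of_dvd (by omega) hd
    omega

lemma NRcountD_one_eq {n ℓ : ℕ} [NeZero n] (h1 : ℓ < n) (h2 : n ≤ 2 * ℓ) (f : ZMod n → Bool) :
    NRcountD n ℓ 1 f =
      (Finset.univ.filter fun a : ZMod n => addOrderOf a = n ∧ f a = true).card := by
  have hn : 0 < n := Nat.pos_of_ne_zero (NeZero.ne n)
  have hl : ℓ ≠ 0 := by omega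
  rw [← Fintype.card_subtype, ← Nat.card_eq_fintype_card]
  unfold NRcountD
  symm
  refine Nat.card_eq_of_bijective
    (fun a : {a : ZMod n // addOrderOf a = n ∧ f a = true} =>
      (⟨Multiset.replicate ℓ a.1, by simp, (zsf_replicate_iff hn h1 h2 _).2 a.2.1, by
        rw [Multiset.toFinset_replicate, if_neg hl]; simp, by
        intro b hb
        rw [Multiset.eq_of_mem_replicate hb]; exact a.2.2⟩ :
        {S : Multiset (ZMod n) //
          Multiset.card S = ℓ ∧ ZeroSumFree S ∧ S.toFinset.card = 1 ∧ ∀ a ∈ S, f a = true}))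
    ⟨?_, ?_⟩
  · intro a b hab
    have := congrArg Subtype.val hab
    simp only at this
    exact Subtype.ext (Multiset.replicate_right_injective hl this)
  · rintro ⟨S, hc, hz, hs, hf⟩
    obtain ⟨a, ha⟩ := Finset.card_eq_one.1 hs
    have hS : S = Multiset.replicate ℓ a := by
      rw [Multiset.eq_replicate]
      refine ⟨hc, fun b hb => ?_⟩
      have : b ∈ S.toFinset := Multiset.mem_toFinset.2 hb
      rw [ha] at this
      simpa using this
    refine ⟨⟨a, ?_, ?_⟩, ?_⟩
    · rw [hS] at hz
      exact (zsf_replicate_iff hn h1 h2 a).1 hz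
    · apply hf
      rw [hS]
      exact Multiset.mem_replicate.2 ⟨hl, rfl⟩
    · exact Subtype.ext hS.symm

instance inst_s15 (p : ℝ) : IsProbabilityMeasure (bernoulliMeasure p) := by
  unfold bernoulliMeasure
  infer_instance

lemma integral_bm {p : ℝ} (hp : p ∈ Set.Icc (0 : ℝ) 1) (g : Bool → ℝ) :
    ∫ b, g b ∂(bernoulliMeasure p) = p * g true + (1 - p) * g false := by
  have h : min (Real.toNNReal p) 1 = Real.toNNReal p := by simpa using hp.2
  have h' : Real.toNNReal p ≤ 1 := by simpa using hp.2
  unfold bernoulliMeasure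
  rw [PMF.integral_eq_sum]
  simp [PMF.bernoulli, hp.1, hp.2]

/-- indicator -/
noncomputable def bInd : Bool → ℝ := fun b => if b = true then 1 else 0

lemma var_bInd {p : ℝ} (hp : p ∈ Set.Icc (0 : ℝ) 1) :
    ProbabilityTheory.variance bInd (bernoulliMeasure p) = p * (1 - p) := by
  rw [ProbabilityTheory.variance_eq_sub MemLp.of_discrete]
  simp only [Pi.pow_apply, integral_bm hp]
  simp [bInd]; ring

lemma cheb {n ℓ : ℕ} (hn : 0 < n) (h1 : ℓ < n) (h2 : n ≤ 2 * ℓ) {p w : ℝ}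
    (hp : p ∈ Set.Icc (0 : ℝ) 1) (hp0 : 0 < p) (hw : 0 < w) :
    1 - ENNReal.ofReal (1 / w ^ 2) ≤ productMeasure n p
      {f | p * (Nat.totient n : ℝ) - w * Real.sqrt (p * (Nat.totient n : ℝ))
                ≤ (NRcountD n ℓ 1 f : ℝ) ∧
              (NRcountD n ℓ 1 f : ℝ)
                ≤ p * (Nat.totient n : ℝ) + w * Real.sqrt (p * (Nat.totient n : ℝ))} ∧
    productMeasure n p
      {f | p * (Nat.totient n : ℝ) - w * Real.sqrt (p * (Nat.totient n : ℝ))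
                ≤ (NRcountD n ℓ 1 f : ℝ) ∧
              (NRcountD n ℓ 1 f : ℝ)
                ≤ p * (Nat.totient n : ℝ) + w * Real.sqrt (p * (Nat.totient n : ℝ))} ≤ 1 := by
  obtain ⟨m, rfl⟩ : ∃ m, n = m + 1 := ⟨n - 1, by omega⟩
  set n := m + 1 with hnm
  have hμ : productMeasure n p = Measure.pi fun _ : ZMod n => bernoulliMeasure p := rfl
  rw [hμ]
  set μ := Measure.pi fun _ : ZMod n => bernoulliMeasure p with hμdef
  refine ⟨?_, prob_le_one⟩
  set φ : ℝ := (Nat.totient n : ℝ) with hφ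
  have hφ0 : 0 < φ := by
    rw [hφ]; exact_mod_cast Nat.totient_pos.2 hn
  let Xi : ZMod n → Bool → ℝ := fun a b => (if addOrderOf a = n then 1 else 0) * bInd b
  let Z : (ZMod n → Bool) → ℝ := ∑ a : ZMod n, fun f => Xi a (f a)
  have hcard : ((Finset.univ.filter fun a : ZMod n => addOrderOf a = n).card : ℝ) = φ := by
    rw [hφ, ← IsAddCyclic.card_addOrderOf_eq_totient (α := ZMod n) (d := n) (by simp)]
  have hZ : ∀ f, (NRcountD n ℓ 1 f : ℝ) = Z f := by
    intro f
    rw [NRcountD_one_eq h1 h2]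
    simp only [Z, Xi, bInd, Finset.sum_apply, Finset.card_filter]
    push_cast
    refine Finset.sum_congr rfl fun a _ => ?_
    by_cases ha : addOrderOf a = n <;> by_cases hb : f a = true <;> simp [ha, hb]
  have hE : ∫ f, Z f ∂μ = p * φ := by
    simp only [Z, Finset.sum_apply]
    rw [integral_finset_sum _ (fun i _ => Integrable.of_finite)]
    have : ∀ a : ZMod n, ∫ f, Xi a (f a) ∂μ = (if addOrderOf a = n then 1 else 0) * p := by
      intro a
      rw [hμdef, integral_comp_eval (f := Xi a) (μ := fun _ : ZMod n => bernoulliMeasure p)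
        (by exact (measurable_of_finite _).aestronglyMeasurable), integral_bm hp]
      simp [Xi, bInd, mul_comm]
    rw [Finset.sum_congr rfl (fun a _ => this a), ← Finset.sum_mul, ← hcard, Finset.card_filter]
    push_cast
    ring
  have hV : ProbabilityTheory.variance Z μ ≤ p * φ := by
    simp only [Z]
    rw [hμdef, ProbabilityTheory.variance_sum_pi (fun i => MemLp.of_discrete)]
    have : ∀ a : ZMod n, ProbabilityTheory.variance (Xi a) (bernoulliMeasure p)
        = (if addOrderOf a = n then 1 else 0) * (p * (1 - p)) := by
      intro a
      simp only [Xi]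
      rw [ProbabilityTheory.variance_const_mul, var_bInd hp]
      split_ifs <;> simp
    rw [Finset.sum_congr rfl (fun a _ => this a), ← Finset.sum_mul]
    have h3 : (∑ a : ZMod n, if addOrderOf a = n then (1:ℝ) else 0) = φ := by
      rw [← hcard, Finset.card_filter]; push_cast; rfl
    rw [h3]
    nlinarith [mul_nonneg hφ0.le (mul_nonneg hp0.le hp0.le)]
  have hs : 0 < Real.sqrt (p * φ) := Real.sqrt_pos.2 (mul_pos hp0 hφ0)
  have hC := ProbabilityTheory.meas_ge_le_variance_div_sq (μ := μ) (X := Z) MemLp.of_discrete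
    (mul_pos hw hs)
  have hC2 : μ {f | w * Real.sqrt (p * φ) ≤ |Z f - ∫ f, Z f ∂μ|} ≤ ENNReal.ofReal (1 / w ^ 2) := by
    refine hC.trans (ENNReal.ofReal_le_ofReal ?_)
    rw [mul_pow, Real.sq_sqrt (mul_pos hp0 hφ0).le, div_le_div_iff₀ (by positivity) (by positivity)]
    nlinarith [sq_nonneg w, mul_le_mul_of_nonneg_right hV (sq_nonneg w)]
  refine (tsub_le_tsub_left hC2 1).trans ?_
  rw [← prob_compl_eq_one_sub (Set.toFinite _).measurableSet]
  refine measure_mono fun f hf => ?_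
  simp only [Set.mem_compl_iff, Set.mem_setOf_eq, not_le, hE] at hf
  have := abs_lt.1 hf
  simp only [Set.mem_setOf_eq, hZ]
  constructor <;> linarith [this.1, this.2]

open Filter in
/-- Concentration of `N^R_{n-1-k,1}`. -/
theorem concentration_NRcountD_one (k : ℕ → ℕ) (hk : ∀ n, 2 ≤ n → k n ≤ n / 3)
    (p : ℕ → ℝ) (hp01 : ∀ n, p n ∈ Set.Icc (0 : ℝ) 1)
    (hlower : Tendsto (fun n : ℕ => p n * n / Real.log (Real.log n)) atTop atTop)
    (ω : ℕ → ℝ) (hω : Tendsto ω atTop atTop) :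
    Tendsto (fun n : ℕ =>
        productMeasure n (p n)
          {f | p n * (Nat.totient n : ℝ)
                  - ω n * Real.sqrt (p n * (Nat.totient n : ℝ))
                ≤ (NRcountD n (n - 1 - k n) 1 f : ℝ) ∧
              (NRcountD n (n - 1 - k n) 1 f : ℝ)
                ≤ p n * (Nat.totient n : ℝ)
                  + ω n * Real.sqrt (p n * (Nat.totient n : ℝ))})
      atTop (nhds 1) := by
  have hlim : Tendsto (fun n : ℕ => 1 - ENNReal.ofReal (1 / ω n ^ 2)) atTop (nhds 1) := by
    have h1 : Tendsto (fun n : ℕ => 1 / ω n ^ 2) atTop (nhds 0) := by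
      simp only [one_div]
      exact tendsto_inv_atTop_zero.comp ((tendsto_pow_atTop two_ne_zero).comp hω)
    have h2 := ENNReal.tendsto_ofReal h1
    have h3 := ENNReal.Tendsto.sub (tendsto_const_nhds (x := (1 : ENNReal))) h2 (Or.inl (by simp))
    simpa using h3
  have hev : ∀ᶠ n : ℕ in atTop, 6 ≤ n ∧ 0 < p n ∧ 0 < ω n := by
    filter_upwards [eventually_ge_atTop 6, hlower.eventually_gt_atTop 0,
      hω.eventually_gt_atTop 0] with n h6 hp hw
    refine ⟨h6, lt_of_le_of_ne (hp01 n).1 ?_, hw⟩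
    intro h0
    rw [← h0] at hp
    simp at hp
  have hch : ∀ᶠ n : ℕ in atTop, _ := hev.mono fun n h =>
    cheb (n := n) (ℓ := n - 1 - k n) (by omega) (by omega)
      (by have := hk n (by omega); omega) (hp01 n) h.2.1 h.2.2
  exact tendsto_of_tendsto_of_tendsto_of_le_of_le' hlim tendsto_const_nhds
    (hch.mono fun n h => h.1) (hch.mono fun n h => h.2)
end
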